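/- arXiv:math/9403214 — 3 statements merged into one kernel-verified Lean document; each statement's English description precedes it below -/
import Mathlib

section
/- Let w(x) = A(1−x²)^α |x|^γ on (−1,1) with A > 0, α > −1, γ > −1, and let a_n be the recurrence coefficients of the corresponding orthonormal polynomials. Then lim_{n→∞} 4n(−1)^n (a_n − 1/2) = −γ; that is, a_n = 1/2 − (−1)^n γ/(4n) + o(1/n) as n → ∞. -/
open MeasureTheory

open Polynomial Filter Topology

lemma continuous_mul_abs_rpow {γ : ℝ} (hγ : -1 < γ) :
    Continuous fun x : ℝ => x * |x| ^ γ := by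
  rw [continuous_iff_continuousAt]
  intro x
  rcases eq_or_ne x 0 with rfl | hx
  · have hnorm : ∀ x : ℝ, ‖x * |x| ^ γ‖ = |x| ^ (γ + 1) := fun x => by
      rw [Real.rpow_add_one' (abs_nonneg x) (by linarith), norm_mul, Real.norm_eq_abs,
        Real.norm_of_nonneg (Real.rpow_nonneg (abs_nonneg x) γ), mul_comm]
    have hlim : Tendsto (fun x : ℝ => |x| ^ (γ + 1)) (𝓝 0) (𝓝 0) := by
      have h : Continuous fun x : ℝ => |x| ^ (γ + 1) :=
        continuous_abs.rpow_const fun _ => Or.inr (by linarith)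
      simpa [Real.zero_rpow (by linarith : γ + 1 ≠ 0)] using h.tendsto 0
    rw [ContinuousAt, zero_mul, tendsto_zero_iff_norm_tendsto_zero]
    simpa only [hnorm] using hlim
  · exact continuousAt_id.mul (continuous_abs.continuousAt.rpow_const (Or.inl (abs_ne_zero.2 hx)))

lemma hasDerivAt_mul_abs_rpow (γ : ℝ) {x : ℝ} (hx : x ≠ 0) :
    HasDerivAt (fun x : ℝ => x * |x| ^ γ) ((1 + γ) * |x| ^ γ) x := by
  have h := (hasDerivAt_id x).mul
    ((hasDerivAt_abs hx).rpow_const (p := γ) (Or.inl (abs_ne_zero.2 hx)))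
  refine h.congr_deriv ?_
  have hs : x * (SignType.sign x : ℝ) = |x| := by rw [mul_comm, sign_mul_self]
  have hp : |x| ^ γ = |x| ^ (γ - 1) * |x| := by
    rw [← Real.rpow_add_one (abs_ne_zero.2 hx), sub_add_cancel]
  rw [hp, id]
  linear_combination γ * |x| ^ (γ - 1) * hs

/-- The Pearson equation of the generalized Gegenbauer weight, in weak form. -/
lemma integral_pearson_eq_zero {α γ : ℝ} (hα : -1 < α) (hγ : -1 < γ) (Q : ℝ[X])
    (hint : IntegrableOn (fun x : ℝ => eval x (X * (1 - X ^ 2) * derivative Q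
      + (C (1 + γ) - C (3 + γ + 2 * α) * X ^ 2) * Q) * ((1 - x ^ 2) ^ α * |x| ^ γ))
      (Set.Ioo (-1) 1)) :
    ∫ x in Set.Ioo (-1 : ℝ) 1, eval x (X * (1 - X ^ 2) * derivative Q
      + (C (1 + γ) - C (3 + γ + 2 * α) * X ^ 2) * Q) * ((1 - x ^ 2) ^ α * |x| ^ γ) = 0 := by
  have hle : (-1 : ℝ) ≤ 1 := by norm_num
  rw [← integral_Ioc_eq_integral_Ioo, ← intervalIntegral.integral_of_le hle]
  rw [integral_eq_of_hasDerivAt_off_countable_of_le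
    (fun x : ℝ => x * |x| ^ γ * (1 - x ^ 2) ^ (α + 1) * eval x Q) _ hle
    (Set.countable_singleton (0 : ℝ))]
  · simp [Real.zero_rpow (by linarith : α + 1 ≠ 0)]
  · refine Continuous.continuousOn (((continuous_mul_abs_rpow hγ).mul ?_).mul Q.continuous)
    exact (by fun_prop : Continuous fun x : ℝ => 1 - x ^ 2).rpow_const
      fun _ => Or.inr (by linarith)
  · rintro x ⟨⟨hx₁, hx₂⟩, hx₀⟩
    have hpos : 0 < 1 - x ^ 2 := by nlinarith
    have hd := ((hasDerivAt_pow 2 x).const_sub 1).rpow_const (p := α + 1) (Or.inl hpos.ne')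
    refine (((hasDerivAt_mul_abs_rpow γ hx₀).mul hd).mul (Q.hasDerivAt x)).congr_deriv ?_
    have hpow := Real.rpow_add_one hpos.ne' α
    simp only [Pi.mul_apply, add_sub_cancel_right, hpow, Nat.cast_ofNat, eval_add, eval_mul, eval_sub,
      eval_X, eval_one, eval_pow, eval_C]
    ring
  · rw [intervalIntegrable_iff_integrableOn_Ioo_of_le hle]
    exact hint

section OrthonormalPolynomials

variable {L : ℝ[X] →ₗ[ℝ] ℝ} {p : ℕ → ℝ[X]} {a b : ℕ → ℝ}

lemma map_C_mul (L : ℝ[X] →ₗ[ℝ] ℝ) (r : ℝ) (P : ℝ[X]) : L (C r * P) = r * L P := by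
  rw [← smul_eq_C_mul, map_smul, smul_eq_mul]

/-- An orthonormal polynomial is orthogonal to every polynomial of lower degree. -/
lemma map_mul_eq_zero_of_degree_lt (hdeg : ∀ n, (p n).natDegree = n) (hp : ∀ n, p n ≠ 0)
    (horth : ∀ m n, L (p m * p n) = if m = n then 1 else 0) {P : ℝ[X]} {n : ℕ}
    (hP : P.degree < n) : L (P * p n) = 0 := by
  have hspan : ∀ k (P : ℝ[X]), k ≤ n → P.degree < k → L (P * p n) = 0 := by
    intro k
    induction k with
    | zero => intro P _ hP; simp [degree_eq_bot.1 (by simpa using hP)]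
    | succ k ih =>
      intro P hk hP
      have hlc : (p k).coeff k ≠ 0 := by
        simpa [leadingCoeff, hdeg] using leadingCoeff_ne_zero.2 (hp k)
      have hlow : (P - C (P.coeff k / (p k).coeff k) * p k).degree < k := by
        rw [degree_lt_iff_coeff_zero] at hP ⊢
        intro m hm
        rcases hm.eq_or_lt with rfl | hm
        · simp [hlc]
        · simp [hP m hm, coeff_eq_zero_of_natDegree_lt ((hdeg k).trans_lt hm)]
      have h := ih _ (by omega) hlow
      rw [sub_mul, map_sub, mul_assoc, map_C_mul, horth, if_neg (by omega)] at h
      simpa using h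
  exact hspan n P le_rfl hP

/-- Pairing a polynomial of degree at most `n` with `p n` extracts its leading coefficient. -/
lemma map_mul_eq_coeff_div (hdeg : ∀ n, (p n).natDegree = n) (hp : ∀ n, p n ≠ 0)
    (horth : ∀ m n, L (p m * p n) = if m = n then 1 else 0) {P : ℝ[X]} {n : ℕ}
    (hP : P.natDegree ≤ n) : L (P * p n) = P.coeff n / (p n).coeff n := by
  have hlc : (p n).coeff n ≠ 0 := by
    simpa [leadingCoeff, hdeg] using leadingCoeff_ne_zero.2 (hp n)
  have hlow : (P - C (P.coeff n / (p n).coeff n) * p n).degree < n := by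
    rw [degree_lt_iff_coeff_zero]
    intro m hm
    rcases hm.eq_or_lt with rfl | hm
    · simp [hlc]
    · simp [coeff_eq_zero_of_natDegree_lt (hP.trans_lt hm),
        coeff_eq_zero_of_natDegree_lt ((hdeg n).trans_lt hm)]
  have h := map_mul_eq_zero_of_degree_lt hdeg hp horth hlow
  rw [sub_mul, map_sub, mul_assoc, map_C_mul, horth, if_pos rfl] at h
  linarith

/-- For an even functional the diagonal recurrence coefficients vanish and `p n` has the parity
of `n`. -/
lemma diag_eq_zero_and_comp_neg_X (hdeg : ∀ n, (p n).natDegree = n)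
    (horth : ∀ m n, L (p m * p n) = if m = n then 1 else 0)
    (heven : ∀ P : ℝ[X], L (P.comp (-X)) = L P)
    (ha0 : a 0 = 0) (hapos : ∀ n, 1 ≤ n → 0 < a n)
    (hrec : ∀ n, C (a (n + 1)) * p (n + 1) = (X - C (b n)) * p n - C (a n) * p (n - 1)) (n : ℕ) :
    b n = 0 ∧ (p n).comp (-X) = (-1) ^ n * p n := by
  have hdiag : ∀ n, (p n).comp (-X) = (-1) ^ n * p n → b n = 0 := by
    intro n hn
    have h₁ : L (X * (p n * p n)) = 0 := by
      have h := heven (X * (p n * p n))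
      rw [mul_comp, mul_comp, hn, X_comp] at h
      have hsq : ((-1 : ℝ[X]) ^ n) ^ 2 = 1 := by rw [← pow_mul, mul_comm, pow_mul]; simp
      have hneg : -X * ((-1) ^ n * p n * ((-1) ^ n * p n)) = -(X * (p n * p n)) := by
        linear_combination (-X * (p n * p n)) * hsq
      rw [hneg, map_neg] at h
      linarith
    have h₂ : X * (p n * p n) = C (a (n + 1)) * (p (n + 1) * p n) + C (b n) * (p n * p n)
        + C (a n) * (p (n - 1) * p n) := by
      linear_combination (-p n) * hrec n
    rw [h₂, map_add, map_add, map_C_mul, map_C_mul, map_C_mul, horth, horth, horth,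
      if_neg (by omega), if_pos rfl] at h₁
    rcases n with _ | n
    · simpa [ha0] using h₁
    · simpa using h₁
  suffices h : ∀ n, (p n).comp (-X) = (-1) ^ n * p n from ⟨hdiag n (h n), h n⟩
  intro n
  induction n using Nat.strong_induction_on with
  | _ n ih =>
    rcases n with _ | n
    · rw [eq_C_of_natDegree_eq_zero (hdeg 0)]
      simp
    · have hn := ih n (by omega)
      have hC : C (a (n + 1)) ≠ 0 := C_ne_zero.2 (hapos (n + 1) (by omega)).ne'
      have hr := hrec n
      rw [hdiag n hn, C_0, sub_zero] at hr
      have hc := congrArg (fun P : ℝ[X] => P.comp (-X)) hr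
      simp only [mul_comp, sub_comp, C_comp, X_comp] at hc
      apply mul_left_cancel₀ hC
      rw [hc, hn]
      rcases n with _ | n
      · simp only [ha0, C_0] at hr ⊢
        linear_combination hr
      · rw [Nat.add_sub_cancel] at hr ⊢
        rw [ih n (by omega)]
        linear_combination (-1) ^ (n + 1) * hr

lemma coeff_eq_zero_of_comp_neg_X {P : ℝ[X]} {n j : ℕ} (hP : P.comp (-X) = (-1) ^ n * P)
    (hj : Odd (n + j)) : P.coeff j = 0 := by
  have h := congrArg (fun Q : ℝ[X] => Q.coeff j) hP
  have hX : (-X : ℝ[X]) = C (-1) * X := by simp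
  have hs : ((-1 : ℝ[X]) ^ n) = C ((-1) ^ n) := by simp
  simp only [hX, hs, comp_C_mul_X_coeff, coeff_C_mul] at h
  have hpow : (-1 : ℝ) ^ n * (-1) ^ j = -1 := by rw [← pow_add, hj.neg_one_pow]
  rcases neg_one_pow_eq_or ℝ n with hn | hn <;> rw [hn] at h hpow
  · have : (-1 : ℝ) ^ j = -1 := by linarith
    rw [this] at h; linarith
  · have : (-1 : ℝ) ^ j = 1 := by linarith
    rw [this] at h; linarith

/-- The subleading coefficient of `p n` in terms of the recurrence coefficients. -/
lemma coeff_X_sq_mul_succ (hdeg : ∀ n, (p n).natDegree = n) (hlead : ∀ n, 0 < (p n).coeff n)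
    (ha0 : a 0 = 0)
    (hrec : ∀ n, C (a (n + 1)) * p (n + 1) = X * p n - C (a n) * p (n - 1)) (n : ℕ) :
    (X ^ 2 * p (n + 1)).coeff (n + 1) / (p (n + 1)).coeff (n + 1)
      = (X ^ 2 * p n).coeff n / (p n).coeff n - a n ^ 2 := by
  have hκ : ∀ n, a (n + 1) * (p (n + 1)).coeff (n + 1) = (p n).coeff n := by
    intro n
    have h := congrArg (fun Q : ℝ[X] => Q.coeff (n + 1)) (hrec n)
    have hz : (p (n - 1)).coeff (n + 1) = 0 :=
      coeff_eq_zero_of_natDegree_lt (by rw [hdeg]; omega)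
    simpa [hz] using h
  have hsub : a (n + 1) * (X ^ 2 * p (n + 1)).coeff (n + 1)
      = (X ^ 2 * p n).coeff n - a n * (X ^ 2 * p (n - 1)).coeff (n + 1) := by
    have h := congrArg (fun Q : ℝ[X] => (X ^ 2 * Q).coeff (n + 1)) (hrec n)
    have e₁ : X ^ 2 * (C (a (n + 1)) * p (n + 1)) = C (a (n + 1)) * (X ^ 2 * p (n + 1)) := by ring
    have e₂ : X ^ 2 * (X * p n - C (a n) * p (n - 1))
        = X * (X ^ 2 * p n) - C (a n) * (X ^ 2 * p (n - 1)) := by ring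
    simpa only [e₁, e₂, coeff_sub, coeff_C_mul, coeff_X_mul] using h
  have hlast : a n * (X ^ 2 * p (n - 1)).coeff (n + 1) = a n ^ 2 * (p n).coeff n := by
    rcases n with _ | n
    · simp [ha0]
    · rw [Nat.add_sub_cancel, coeff_X_pow_mul (p n) 2 n, ← hκ n]
      ring
  rw [hlast] at hsub
  have h₁ := (hlead n).ne'
  have h₂ := (hlead (n + 1)).ne'
  have h₃ : a (n + 1) ≠ 0 := fun h => h₁ (by rw [← hκ n, h, zero_mul])
  have h₄ : (X ^ 2 * p (n + 1)).coeff (n + 1)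
      = ((X ^ 2 * p n).coeff n - a n ^ 2 * (p n).coeff n) / a (n + 1) := by
    rw [← hsub]; field_simp
  rw [h₄, div_div, hκ n]
  field_simp

/-- The Laguerre–Freud equation of an even functional satisfying the generalized Gegenbauer
Pearson equation. -/
lemma laguerre_freud {γ K : ℝ} (hdeg : ∀ n, (p n).natDegree = n) (hp : ∀ n, p n ≠ 0)
    (horth : ∀ m n, L (p m * p n) = if m = n then 1 else 0)
    (hpar : ∀ n, (p n).comp (-X) = (-1) ^ n * p n)
    (hrec : ∀ n, C (a (n + 1)) * p (n + 1) = X * p n - C (a n) * p (n - 1))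
    (hpearson : ∀ Q, L (X * (1 - X ^ 2) * derivative Q + (C (1 + γ) - C K * X ^ 2) * Q) = 0)
    (n : ℕ) :
    (2 * n + K) * (a n ^ 2 + a (n + 1) ^ 2)
      = 2 * n + 1 + γ + 4 * ((X ^ 2 * p n).coeff n / (p n).coeff n) := by
  set U : ℝ[X] := X * derivative (p n) - C (n : ℝ) * p n with hU
  have hUcoeff : ∀ j, U.coeff j = ((j : ℝ) - n) * (p n).coeff j := by
    intro j
    rcases j with _ | j
    · simp [hU]
    · simp [hU, coeff_derivative]
      ring
  have hVcoeff : ∀ j : ℕ, (X ^ 2 * U).coeff j = ((j : ℝ) - 2 - n) * (X ^ 2 * p n).coeff j := by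
    intro j
    rw [coeff_X_pow_mul', coeff_X_pow_mul']
    split_ifs with hj
    · rw [hUcoeff, Nat.cast_sub hj]; simp
    · simp
  have hUdeg : U.natDegree ≤ n := natDegree_le_iff_coeff_eq_zero.2 fun j hj => by
    rw [hUcoeff, coeff_eq_zero_of_natDegree_lt ((hdeg n).trans_lt hj), mul_zero]
  have hVdeg : (X ^ 2 * U).natDegree ≤ n := natDegree_le_iff_coeff_eq_zero.2 fun j hj => by
    rw [hVcoeff, coeff_X_pow_mul']
    split_ifs with h2
    · rcases (by omega : j = n + 1 ∨ j = n + 2 ∨ n < j - 2) with rfl | rfl | h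
      · rw [coeff_eq_zero_of_comp_neg_X (hpar n) ⟨n - 1, by omega⟩, mul_zero]
      · push_cast; ring
      · rw [coeff_eq_zero_of_natDegree_lt ((hdeg n).trans_lt h), mul_zero]
    · simp
  have hLU : L (U * p n) = 0 := by
    rw [map_mul_eq_coeff_div hdeg hp horth hUdeg, hUcoeff]; simp
  have hLV : L (X ^ 2 * U * p n) = -2 * ((X ^ 2 * p n).coeff n / (p n).coeff n) := by
    rw [map_mul_eq_coeff_div hdeg hp horth hVdeg, hVcoeff]; ring
  have hX2 : L (X ^ 2 * (p n * p n)) = a n ^ 2 + a (n + 1) ^ 2 := by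
    have e : X ^ 2 * (p n * p n) = C (a (n + 1) ^ 2) * (p (n + 1) * p (n + 1))
        + C (2 * a (n + 1) * a n) * (p (n + 1) * p (n - 1))
        + C (a n ^ 2) * (p (n - 1) * p (n - 1)) := by
      simp only [C_mul, C_pow, C_ofNat]
      linear_combination (-(X * p n) - C (a (n + 1)) * p (n + 1) - C (a n) * p (n - 1)) * hrec n
    rw [e, map_add, map_add, map_C_mul, map_C_mul, map_C_mul, horth, horth, horth, if_pos rfl,
      if_pos rfl, if_neg (by omega)]
    ring
  have hmain := hpearson (p n * p n)
  have e : X * (1 - X ^ 2) * derivative (p n * p n) + (C (1 + γ) - C K * X ^ 2) * (p n * p n)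
      = C (2 * n + 1 + γ) * (p n * p n) - C (2 * n + K) * (X ^ 2 * (p n * p n))
        + C 2 * (U * p n) - C 2 * (X ^ 2 * U * p n) := by
    rw [derivative_mul, hU]
    simp only [C_add, C_mul, C_ofNat, C_1]
    ring
  rw [e, map_sub, map_add, map_sub, map_C_mul, map_C_mul, map_C_mul, map_C_mul, hLU, hLV, hX2,
    horth, if_pos rfl] at hmain
  linarith

end OrthonormalPolynomials

/-- The explicit squared recurrence coefficients of the generalized Gegenbauer weight. -/
lemma sq_recurrence_coeff {α γ : ℝ} (hα : -1 < α) (hγ : -1 < γ) {c : ℕ → ℝ} (h0 : c 0 = 0)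
    (h1 : (3 + γ + 2 * α) * c 1 = 1 + γ)
    (hc : ∀ n : ℕ, (2 * n + 2 + (3 + γ + 2 * α)) * c (n + 2)
      = 2 + (2 * n + (3 + γ + 2 * α) - 4) * c n - 2 * c (n + 1)) (n : ℕ) :
    (4 * n + 2 * α + γ + 1) * (4 * n + 2 * α + γ - 1) * c (2 * n) = (2 * n + 2 * α) * (2 * n) ∧
    (4 * n + 2 * α + γ + 3) * (4 * n + 2 * α + γ + 1) * c (2 * n + 1)
      = (2 * n + 1 + 2 * α + γ) * (2 * n + 1 + γ) := by
  induction n with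
  | zero =>
    refine ⟨by simp [h0], ?_⟩
    simp only [mul_zero, zero_add, Nat.cast_zero]
    linear_combination (1 + 2 * α + γ) * h1
  | succ n ih =>
    obtain ⟨ih₁, ih₂⟩ := ih
    have e₁ := hc (2 * n)
    have e₂ := hc (2 * n + 1)
    rw [show 2 * (n + 1) = 2 * n + 2 by ring]
    push_cast at e₁ e₂ ⊢
    have heven : (4 * (n + 1) + 2 * α + γ + 1) * (4 * (n + 1) + 2 * α + γ - 1) * c (2 * n + 2)
        = (2 * n + 2 + 2 * α) * (2 * n + 2) := by
      rcases n.eq_zero_or_pos with rfl | hn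
      · simp only [mul_zero, zero_add, Nat.cast_zero, h0] at e₁ ⊢
        linear_combination (3 + γ + 2 * α) * e₁ - 2 * h1
      · have hn' : (1 : ℝ) ≤ n := by exact_mod_cast hn
        have hD : 4 * n + 2 * α + γ + 1 ≠ 0 := by linarith
        apply mul_left_cancel₀ hD
        linear_combination (4 * n + 2 * α + γ + 1) * (4 * n + 2 * α + γ + 3) * e₁
          + (4 * n + 2 * α + γ + 3) * ih₁ - 2 * ih₂
    have hn' : (0 : ℝ) ≤ n := n.cast_nonneg
    have hD : 4 * n + 2 * α + γ + 3 ≠ 0 := by linarith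
    refine ⟨by linear_combination heven, ?_⟩
    apply mul_left_cancel₀ hD
    linear_combination (4 * n + 2 * α + γ + 3) * (4 * n + 2 * α + γ + 5) * e₂
      + (4 * n + 2 * α + γ + 5) * ih₂ - 2 * heven

/-- Second-order asymptotics of the explicit squared recurrence coefficients. -/
lemma tendsto_alternating_sq {α γ : ℝ} {c : ℕ → ℝ}
    (hc : ∀ n : ℕ,
      (4 * n + 2 * α + γ + 1) * (4 * n + 2 * α + γ - 1) * c (2 * n) = (2 * n + 2 * α) * (2 * n) ∧
      (4 * n + 2 * α + γ + 3) * (4 * n + 2 * α + γ + 1) * c (2 * n + 1)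
        = (2 * n + 1 + 2 * α + γ) * (2 * n + 1 + γ)) :
    Tendsto (fun n : ℕ => n * (-1 : ℝ) ^ n * (4 * c n - 1)) atTop (𝓝 (-γ)) := by
  set s : ℝ := 2 * α + γ with hs
  set g : ℕ → ℝ := fun n => (-1 : ℝ) ^ n * (1 - s ^ 2) + ((-1 : ℝ) ^ n - 1) * (2 * γ * s) with hg
  have hmul : ∀ n : ℕ, (-1 : ℝ) ^ n * (4 * c n - 1) * ((2 * n + s) ^ 2 - 1)
      = -4 * γ * n + g n := by
    intro n
    rcases n.even_or_odd' with ⟨k, rfl | rfl⟩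
    · have h := (hc k).1
      simp only [hg, (even_two_mul k).neg_one_pow, hs]
      push_cast
      linear_combination 4 * h
    · have h := (hc k).2
      simp only [hg, (odd_two_mul_add_one k).neg_one_pow, hs]
      push_cast
      linear_combination -4 * h
  have hinv : Tendsto (fun n : ℕ => (n : ℝ)⁻¹) atTop (𝓝 0) := tendsto_inv_atTop_nhds_zero_nat
  have hsign : Tendsto (fun n : ℕ => (-1 : ℝ) ^ n * (n : ℝ)⁻¹) atTop (𝓝 0) := by
    rw [tendsto_zero_iff_norm_tendsto_zero]
    simpa using hinv
  have hgn : Tendsto (fun n : ℕ => g n * (n : ℝ)⁻¹) atTop (𝓝 0) := by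
    have h := (hsign.mul_const (1 - s ^ 2 + 2 * γ * s)).sub (hinv.mul_const (2 * γ * s))
    simp only [zero_mul, sub_zero] at h
    refine h.congr fun n => ?_
    simp only [hg]
    ring
  have hlim : Tendsto (fun n : ℕ => (-4 * γ + g n * (n : ℝ)⁻¹)
      / ((2 + s * (n : ℝ)⁻¹) ^ 2 - ((n : ℝ)⁻¹) ^ 2)) atTop (𝓝 (-γ)) := by
    have h := (hgn.const_add (-4 * γ)).div
      ((((hinv.const_mul s).const_add 2).pow 2).sub (hinv.pow 2)) (by norm_num)
    convert h using 2
    norm_num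
    ring
  have hden : Tendsto (fun n : ℕ => (2 + s * (n : ℝ)⁻¹) ^ 2 - ((n : ℝ)⁻¹) ^ 2) atTop (𝓝 4) := by
    have h := (((hinv.const_mul s).const_add 2).pow 2).sub (hinv.pow 2)
    norm_num at h
    simpa using h
  refine hlim.congr' ?_
  filter_upwards [eventually_gt_atTop 0, hden.eventually_ne (by norm_num : (4 : ℝ) ≠ 0)]
    with n hn hne
  have hn' : (n : ℝ) ≠ 0 := by exact_mod_cast hn.ne'
  rw [div_eq_iff hne]
  have h := hmul n
  field_simp
  linear_combination -h

/-- Passing from the asymptotics of `a n ^ 2` to those of `a n`. -/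
lemma tendsto_alternating_of_sq {γ : ℝ} {a : ℕ → ℝ} (ha : ∀ n, 0 ≤ a n)
    (h : Tendsto (fun n : ℕ => n * (-1 : ℝ) ^ n * (4 * a n ^ 2 - 1)) atTop (𝓝 (-γ))) :
    Tendsto (fun n : ℕ => 4 * (n : ℝ) * (-1 : ℝ) ^ n * (a n - 1 / 2)) atTop (𝓝 (-γ)) := by
  have hinv : Tendsto (fun n : ℕ => (n : ℝ)⁻¹) atTop (𝓝 0) := tendsto_inv_atTop_nhds_zero_nat
  have hsmall : Tendsto (fun n : ℕ => 4 * a n ^ 2 - 1) atTop (𝓝 0) := by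
    have h' := (h.mul hinv).norm
    rw [mul_zero, norm_zero] at h'
    rw [tendsto_zero_iff_norm_tendsto_zero]
    refine h'.congr' ?_
    filter_upwards [eventually_gt_atTop 0] with n hn
    have hn' : (n : ℝ) ≠ 0 := by exact_mod_cast hn.ne'
    simp only [norm_mul, norm_pow, norm_neg, norm_one, one_pow, mul_one, norm_inv]
    field_simp [norm_ne_zero_iff.2 hn']
  have ha_lim : Tendsto a atTop (𝓝 (1 / 2)) := by
    have h' := ((hsmall.add_const 1).div_const 4).sqrt
    have hval : √((0 + 1) / 4 : ℝ) = 1 / 2 := by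
      rw [show ((0 + 1) / 4 : ℝ) = (1 / 2) ^ 2 by norm_num, Real.sqrt_sq (by norm_num)]
    rw [hval] at h'
    refine h'.congr fun n => ?_
    rw [show (4 * a n ^ 2 - 1 + 1) / 4 = a n ^ 2 by ring, Real.sqrt_sq (ha n)]
  have hq := h.div (ha_lim.add_const (1 / 2)) (by norm_num)
  norm_num at hq
  refine hq.congr fun n => ?_
  have hne : a n + 1 / 2 ≠ 0 := by linarith [ha n]
  rw [Pi.div_apply, div_eq_iff hne]
  ring

/-- for the weight `w x = A (1-x²)^α |x|^γ` on `(-1,1)`,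
`lim 4n(-1)ⁿ(a n - 1/2) = -γ`, i.e. `a n = 1/2 - (-1)ⁿγ/(4n) + o(1/n)`. -/
theorem stmt4
    (A α γ : ℝ) (hA : 0 < A) (hα : -1 < α) (hγ : -1 < γ)
    (w : ℝ → ℝ)
    (hw : ∀ x ∈ Set.Ioo (-1 : ℝ) 1, w x = A * (1 - x ^ 2) ^ α * |x| ^ γ)
    (hw_int : ∀ P : Polynomial ℝ,
      IntegrableOn (fun x => Polynomial.eval x P * w x) (Set.Ioo (-1 : ℝ) 1))
    (p : ℕ → Polynomial ℝ)
    (hdeg : ∀ n, (p n).natDegree = n)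
    (hlead : ∀ n, 0 < (p n).leadingCoeff)
    (horth : ∀ m n, (∫ x in Set.Ioo (-1 : ℝ) 1,
        Polynomial.eval x (p m) * Polynomial.eval x (p n) * w x)
        = if m = n then 1 else 0)
    (a b : ℕ → ℝ)
    (ha0 : a 0 = 0)
    (hapos : ∀ n, 1 ≤ n → 0 < a n)
    (hrec : ∀ n : ℕ, ∀ x : ℝ, a (n + 1) * Polynomial.eval x (p (n + 1))
        = (x - b n) * Polynomial.eval x (p n) - a n * Polynomial.eval x (p (n - 1))) :
    Filter.Tendsto (fun n : ℕ => 4 * (n : ℝ) * (-1 : ℝ) ^ n * (a n - 1 / 2))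
      Filter.atTop (nhds (-γ)) := by
  have hprod : ∀ (P : ℝ[X]) (x : ℝ), x ∈ Set.Ioo (-1 : ℝ) 1 →
      eval x P * w x = A * (eval x P * ((1 - x ^ 2) ^ α * |x| ^ γ)) := fun P x hx => by
    rw [hw x hx]; ring
  let L : ℝ[X] →ₗ[ℝ] ℝ :=
    { toFun := fun P => ∫ x in Set.Ioo (-1 : ℝ) 1, eval x P * w x
      map_add' := fun P Q => by
        simp only [eval_add, add_mul]
        exact integral_add (hw_int P) (hw_int Q)
      map_smul' := fun r P => by
        simp only [eval_smul, smul_eq_mul, mul_assoc, RingHom.id_apply]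
        exact integral_const_mul r _ }
  have hL : ∀ P, L P = ∫ x in Set.Ioo (-1 : ℝ) 1, eval x P * w x := fun _ => rfl
  have horthL : ∀ m n, L (p m * p n) = if m = n then 1 else 0 := fun m n => by
    rw [hL, ← horth m n]
    simp only [eval_mul]
  have hp : ∀ n, p n ≠ 0 := fun n => leadingCoeff_ne_zero.1 (hlead n).ne'
  have heven : ∀ P : ℝ[X], L (P.comp (-X)) = L P := by
    intro P
    have hle : (-1 : ℝ) ≤ 1 := by norm_num
    have hrefl : ∀ x ∈ Set.Ioo (-1 : ℝ) 1,
        eval x (P.comp (-X)) * w x = (fun y => eval y P * w y) (-x) := by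
      intro x hx
      have hx' : -x ∈ Set.Ioo (-1 : ℝ) 1 := ⟨by linarith [hx.2], by linarith [hx.1]⟩
      simp [hw x hx, hw (-x) hx', eval_comp]
    rw [hL, hL, setIntegral_congr_fun measurableSet_Ioo hrefl, ← integral_Ioc_eq_integral_Ioo,
      ← integral_Ioc_eq_integral_Ioo, ← intervalIntegral.integral_of_le hle,
      ← intervalIntegral.integral_of_le hle,
      intervalIntegral.integral_comp_neg (fun y => eval y P * w y), neg_neg]
  have hpearson : ∀ Q, L (X * (1 - X ^ 2) * derivative Q
      + (C (1 + γ) - C (3 + γ + 2 * α) * X ^ 2) * Q) = 0 := by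
    intro Q
    rw [hL, setIntegral_congr_fun measurableSet_Ioo (hprod _), integral_const_mul,
      integral_pearson_eq_zero hα hγ Q, mul_zero]
    have h := ((hw_int _).congr_fun (hprod (X * (1 - X ^ 2) * derivative Q
      + (C (1 + γ) - C (3 + γ + 2 * α) * X ^ 2) * Q)) measurableSet_Ioo).const_mul A⁻¹
    simpa only [IntegrableOn, inv_mul_cancel_left₀ hA.ne'] using h
  have hrecb : ∀ n, C (a (n + 1)) * p (n + 1) = (X - C (b n)) * p n - C (a n) * p (n - 1) :=
    fun n => Polynomial.funext fun x => by simpa using hrec n x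
  have hdiag := diag_eq_zero_and_comp_neg_X hdeg horthL heven ha0 hapos hrecb
  have hrecX : ∀ n, C (a (n + 1)) * p (n + 1) = X * p n - C (a n) * p (n - 1) := fun n => by
    rw [hrecb n, (hdiag n).1, C_0, sub_zero]
  have hlc : ∀ n, 0 < (p n).coeff n := fun n => by
    simpa only [leadingCoeff, hdeg] using hlead n
  have hfreud := laguerre_freud hdeg hp horthL (fun n => (hdiag n).2) hrecX hpearson
  have ha : ∀ n, 0 ≤ a n := fun n => by
    rcases n.eq_zero_or_pos with rfl | hn
    · exact ha0.ge
    · exact (hapos n hn).le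
  refine tendsto_alternating_of_sq ha (tendsto_alternating_sq
    (sq_recurrence_coeff hα hγ (c := fun n => a n ^ 2) (by simp [ha0]) ?_ fun n => ?_))
  · have h := hfreud 0
    simp only [ha0, coeff_X_pow_mul', Nat.cast_zero] at h
    norm_num at h
    linarith
  · have h₁ := hfreud n
    have h₂ := hfreud (n + 1)
    rw [coeff_X_sq_mul_succ hdeg hlc ha0 hrecX n] at h₂
    push_cast at h₂
    linear_combination h₂ - h₁
end

section
/- Let w be a weight function on (−1,1) with orthonormal polynomials p_n and recurrence coefficients a_n, b_n, let w̃(x) = 2|x| w(2x²−1) on (−1,1) with orthonormal polynomials p̃_n and recurrence coefficients ã_n (ã_0 = 0). Then a_n = 2 ã_{2n−1} ã_{2n} for every n ≥ 1, and b_n = −1 + 2 ã_{2n}² + 2 ã_{2n+1}² for every n ≥ 0. -/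
open MeasureTheory

open Polynomial in
/-- Integration of polynomials against a weight, as a linear functional. -/
theorem exists_linearMap_integral_mul_weight (w : ℝ → ℝ) (s : Set ℝ)
    (hw : ∀ P : ℝ[X], IntegrableOn (fun x => P.eval x * w x) s) :
    ∃ I : ℝ[X] →ₗ[ℝ] ℝ, ∀ P, I P = ∫ x in s, P.eval x * w x := by
  refine ⟨{ toFun := fun P => ∫ x in s, P.eval x * w x, map_add' := ?_, map_smul' := ?_ },
    fun P => rfl⟩
  · intro P Q
    rw [← integral_add (hw P) (hw Q)]
    simp only [eval_add, add_mul]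
  · intro c P
    rw [RingHom.id_apply, smul_eq_mul, ← integral_const_mul]
    simp only [eval_smul, smul_eq_mul, mul_assoc]

/-- The map `x ↦ 2x² - 1` sends the measure `2|x| dx` on `(-1, 1)` to Lebesgue measure. -/
theorem integral_two_mul_abs_mul_comp_two_mul_sq_sub_one (f : ℝ → ℝ) :
    ∫ x in Set.Ioo (-1 : ℝ) 1, 2 * |x| * f (2 * x ^ 2 - 1) = ∫ x in Set.Ioo (-1 : ℝ) 1, f x := by
  have himage : (fun x : ℝ => 2 * x ^ 2 - 1) '' Set.Ioo 0 1 = Set.Ioo (-1) 1 := by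
    ext y
    simp only [Set.mem_image, Set.mem_Ioo]
    constructor
    · rintro ⟨x, ⟨h0, h1⟩, rfl⟩
      constructor <;> nlinarith
    · rintro ⟨h0, h1⟩
      refine ⟨√((y + 1) / 2), ⟨Real.sqrt_pos.2 (by linarith), ?_⟩, ?_⟩
      · rw [Real.sqrt_lt' one_pos]; linarith
      · rw [Real.sq_sqrt (by linarith)]; ring
  have hinj : Set.InjOn (fun x : ℝ => 2 * x ^ 2 - 1) (Set.Ioo 0 1) := by
    intro x hx y hy h
    have hsq : x ^ 2 = y ^ 2 := by simpa using h
    exact (pow_left_inj₀ hx.1.le hy.1.le two_ne_zero).1 hsq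
  have hderiv : ∀ x ∈ Set.Ioo (0 : ℝ) 1,
      HasDerivWithinAt (fun x : ℝ => 2 * x ^ 2 - 1) (4 * x) (Set.Ioo 0 1) x := by
    intro x _
    have h := (((hasDerivAt_pow 2 x).const_mul 2).sub_const 1).hasDerivWithinAt (s := Set.Ioo 0 1)
    exact h.congr_deriv (by norm_num; ring)
  have hsubst := integral_image_eq_integral_abs_deriv_smul measurableSet_Ioo hderiv hinj f
  have habs := integral_comp_abs
    (f := (Set.Iio (1 : ℝ)).indicator fun y => 2 * y * f (2 * y ^ 2 - 1))
  have hind : (fun x : ℝ => (Set.Iio (1 : ℝ)).indicator (fun y => 2 * y * f (2 * y ^ 2 - 1)) |x|)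
      = (Set.Ioo (-1 : ℝ) 1).indicator fun x => 2 * |x| * f (2 * x ^ 2 - 1) := by
    ext x
    simp only [Set.indicator, Set.mem_Iio, Set.mem_Ioo, abs_lt, sq_abs]
  rw [hind, integral_indicator measurableSet_Ioo, setIntegral_indicator measurableSet_Iio,
    Set.Ioi_inter_Iio] at habs
  rw [habs, ← himage, hsubst, ← integral_const_mul]
  refine setIntegral_congr_fun measurableSet_Ioo fun x hx => ?_
  simp only [smul_eq_mul]
  rw [abs_of_pos (by linarith [hx.1])]
  ring

open Polynomial in
/-- Two orthonormal families related through the quadratic substitution `2X² - 1`, the second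
one symmetric: their recurrence coefficients determine each other. -/
theorem recurrence_coeff_of_quadratic_substitution (I : ℝ[X] →ₗ[ℝ] ℝ) (r q : ℕ → ℝ[X])
    (hr : ∀ m n, I (r m * r n) = if m = n then 1 else 0)
    (hq : ∀ m n, I (q m * q n) = if m = n then 1 else 0)
    (h0 : r 0 = q 0) (a b c : ℕ → ℝ) (ha0 : a 0 = 0) (ha : ∀ n, 1 ≤ n → 0 < a n)
    (hc0 : c 0 = 0) (hc : ∀ n, 1 ≤ n → 0 < c n)
    (hrec : ∀ n, C (a (n + 1)) * r (n + 1)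
      = (2 * X ^ 2 - 1 - C (b n)) * r n - C (a n) * r (n - 1))
    (hqrec : ∀ n, C (c (n + 1)) * q (n + 1) = X * q n - C (c n) * q (n - 1)) (n : ℕ) :
    a n = 2 * c (2 * n - 1) * c (2 * n) ∧
      b n = -1 + 2 * c (2 * n) ^ 2 + 2 * c (2 * n + 1) ^ 2 := by
  have hstep : ∀ n, r n = q (2 * n) → r (n - 1) = q (2 * n - 2) →
      a n = 2 * c (2 * n - 1) * c (2 * n) →
      b n = -1 + 2 * c (2 * n) ^ 2 + 2 * c (2 * n + 1) ^ 2 ∧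
      a (n + 1) = 2 * c (2 * n + 1) * c (2 * n + 2) ∧ r (n + 1) = q (2 * n + 2) := by
    intro n hrn hrn1 han
    have hexp : C (a (n + 1)) * r (n + 1) = C (2 * c (2 * n + 1) * c (2 * n + 2)) * q (2 * n + 2)
        + C (-1 + 2 * c (2 * n) ^ 2 + 2 * c (2 * n + 1) ^ 2 - b n) * q (2 * n) := by
      have e1 := hqrec (2 * n + 1)
      have e2 := hqrec (2 * n)
      have e3 : C (c (2 * n)) * (C (c (2 * n)) * q (2 * n))
          = C (c (2 * n)) * (X * q (2 * n - 1) - C (c (2 * n - 1)) * q (2 * n - 2)) := by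
        rcases n with _ | k
        · simp [hc0]
        · have := hqrec (2 * k + 1)
          simp only [show 2 * (k + 1) = 2 * k + 1 + 1 by ring]
          rw [this]
          simp
      rw [hrec n, hrn, hrn1, han]
      simp only [map_add, map_sub, map_mul, map_neg, map_one, map_pow, map_ofNat] at e1 e2 e3 ⊢
      simp only [Nat.add_sub_cancel, show 2 * n + 1 + 1 = 2 * n + 2 by ring] at e1
      linear_combination (-2 * C (c (2 * n + 1))) * e1 - 2 * X * e2 - 2 * e3
    have hb : b n = -1 + 2 * c (2 * n) ^ 2 + 2 * c (2 * n + 1) ^ 2 := by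
      have h1 := congrArg (fun P => I (P * q (2 * n))) hexp
      have h2 := hr (n + 1) n
      rw [hrn] at h2
      simp only [add_mul, mul_assoc, C_mul', smul_mul_assoc, map_add, map_smul, hq, h2,
        smul_eq_mul] at h1
      simp at h1
      linarith
    have hexp' : C (a (n + 1)) * r (n + 1)
        = C (2 * c (2 * n + 1) * c (2 * n + 2)) * q (2 * n + 2) := by
      rw [hexp, hb]; simp
    have hapos := ha (n + 1) (by omega)
    have hcpos : 0 < 2 * c (2 * n + 1) * c (2 * n + 2) :=
      mul_pos (mul_pos two_pos (hc _ (by omega))) (hc _ (by omega))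
    have han' : a (n + 1) = 2 * c (2 * n + 1) * c (2 * n + 2) := by
      have h1 := congrArg (fun P => I (P * P)) hexp'
      simp only [C_mul', smul_mul_assoc, mul_smul_comm, map_smul, hq, hr, smul_eq_mul,
        if_true, mul_one] at h1
      exact (mul_self_inj hapos.le hcpos.le).1 h1
    refine ⟨hb, han', ?_⟩
    rw [han'] at hexp'
    exact mul_left_cancel₀ (C_ne_zero.2 hcpos.ne') hexp'
  have hind : ∀ n, r n = q (2 * n) ∧ r (n - 1) = q (2 * n - 2) ∧
      a n = 2 * c (2 * n - 1) * c (2 * n) := by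
    intro n
    induction n with
    | zero => simp [h0, ha0, hc0]
    | succ n ih =>
      obtain ⟨-, h2, h3⟩ := hstep n ih.1 ih.2.1 ih.2.2
      exact ⟨h3, ih.1, h2⟩
  obtain ⟨h1, h2, h3⟩ := hind n
  exact ⟨h3, (hstep n h1 h2 h3).1⟩

/-- relation between the recurrence coefficients `a n, b n` of `w`
and the coefficients `ã n` of the even weight `wt x = 2|x| w(2x²-1)`:
`a n = 2 ã_{2n-1} ã_{2n}` (n ≥ 1) and `b n = -1 + 2 ã_{2n}² + 2 ã_{2n+1}²`. -/
theorem stmt7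
    (w : ℝ → ℝ)
    (hw_nonneg : ∀ x ∈ Set.Ioo (-1 : ℝ) 1, 0 ≤ w x)
    (hw_int : ∀ P : Polynomial ℝ,
      IntegrableOn (fun x => Polynomial.eval x P * w x) (Set.Ioo (-1 : ℝ) 1))
    (hw_pos : 0 < ∫ x in Set.Ioo (-1 : ℝ) 1, w x)
    (p : ℕ → Polynomial ℝ)
    (hdeg : ∀ n, (p n).natDegree = n)
    (hlead : ∀ n, 0 < (p n).leadingCoeff)
    (horth : ∀ m n, (∫ x in Set.Ioo (-1 : ℝ) 1,
        Polynomial.eval x (p m) * Polynomial.eval x (p n) * w x)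
        = if m = n then 1 else 0)
    (a b : ℕ → ℝ)
    (ha0 : a 0 = 0)
    (hapos : ∀ n, 1 ≤ n → 0 < a n)
    (hrec : ∀ n : ℕ, ∀ x : ℝ, a (n + 1) * Polynomial.eval x (p (n + 1))
        = (x - b n) * Polynomial.eval x (p n) - a n * Polynomial.eval x (p (n - 1)))
    (wt : ℝ → ℝ)
    (hwt : ∀ x ∈ Set.Ioo (-1 : ℝ) 1, wt x = 2 * |x| * w (2 * x ^ 2 - 1))
    (hwt_int : ∀ P : Polynomial ℝ,
      IntegrableOn (fun x => Polynomial.eval x P * wt x) (Set.Ioo (-1 : ℝ) 1))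
    (pt : ℕ → Polynomial ℝ)
    (htdeg : ∀ n, (pt n).natDegree = n)
    (htlead : ∀ n, 0 < (pt n).leadingCoeff)
    (htorth : ∀ m n, (∫ x in Set.Ioo (-1 : ℝ) 1,
        Polynomial.eval x (pt m) * Polynomial.eval x (pt n) * wt x)
        = if m = n then 1 else 0)
    (aa : ℕ → ℝ)
    (haa0 : aa 0 = 0)
    (haapos : ∀ n, 1 ≤ n → 0 < aa n)
    (htrec : ∀ n : ℕ, ∀ x : ℝ, aa (n + 1) * Polynomial.eval x (pt (n + 1))
        = x * Polynomial.eval x (pt n) - aa n * Polynomial.eval x (pt (n - 1))) :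
    (∀ n : ℕ, 1 ≤ n → a n = 2 * aa (2 * n - 1) * aa (2 * n)) ∧
    (∀ n : ℕ, b n = -1 + 2 * (aa (2 * n)) ^ 2 + 2 * (aa (2 * n + 1)) ^ 2) := by
  obtain ⟨I, hI⟩ := exists_linearMap_integral_mul_weight wt (Set.Ioo (-1) 1) hwt_int
  set T : Polynomial ℝ := 2 * Polynomial.X ^ 2 - 1 with hT
  have hcomp : ∀ P : Polynomial ℝ,
      I (P.comp T) = ∫ x in Set.Ioo (-1 : ℝ) 1, P.eval x * w x := by
    intro P
    rw [hI, ← integral_two_mul_abs_mul_comp_two_mul_sq_sub_one fun x => P.eval x * w x]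
    refine setIntegral_congr_fun measurableSet_Ioo fun x hx => ?_
    simp only [hwt x hx, hT, Polynomial.eval_comp, Polynomial.eval_sub, Polynomial.eval_mul,
      Polynomial.eval_pow, Polynomial.eval_X, Polynomial.eval_one, Polynomial.eval_ofNat]
    ring
  have hr : ∀ m n, I ((p m).comp T * (p n).comp T) = if m = n then 1 else 0 := by
    intro m n
    rw [← Polynomial.mul_comp, hcomp, ← horth m n]
    simp only [Polynomial.eval_mul]
  have hq : ∀ m n, I (pt m * pt n) = if m = n then 1 else 0 := by
    intro m n
    rw [hI, ← htorth m n]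
    simp only [Polynomial.eval_mul]
  have h0 : (p 0).comp T = pt 0 := by
    have hp := Polynomial.eq_C_of_natDegree_eq_zero (hdeg 0)
    have hpt := Polynomial.eq_C_of_natDegree_eq_zero (htdeg 0)
    have hppos : 0 < (p 0).coeff 0 := by simpa [Polynomial.leadingCoeff, hdeg 0] using hlead 0
    have hptpos : 0 < (pt 0).coeff 0 := by simpa [Polynomial.leadingCoeff, htdeg 0] using htlead 0
    have h1 := hr 0 0
    have h2 := hq 0 0
    rw [hp, Polynomial.C_comp, ← mul_one (Polynomial.C _ * _), ← Polynomial.C_mul,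
      Polynomial.C_mul', map_smul, smul_eq_mul, if_pos rfl] at h1
    rw [hpt, ← mul_one (Polynomial.C _ * _), ← Polynomial.C_mul,
      Polynomial.C_mul', map_smul, smul_eq_mul, if_pos rfl] at h2
    have hne : I 1 ≠ 0 := right_ne_zero_of_mul_eq_one h1
    have hcoeff := (mul_self_inj hppos.le hptpos.le).1 (mul_right_cancel₀ hne (h1.trans h2.symm))
    rw [hp, hpt, Polynomial.C_comp, hcoeff]
  have key := recurrence_coeff_of_quadratic_substitution I (fun n => (p n).comp T) pt hr hq h0
    a b aa ha0 hapos haa0 haapos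
    (fun n => Polynomial.funext fun x => by
      simpa [hT, Polynomial.eval_comp] using hrec n (2 * x ^ 2 - 1))
    (fun n => Polynomial.funext fun x => by simpa using htrec n x)
  exact ⟨fun n _ => (key n).1, fun n => (key n).2⟩
end

section
/- Let w̃ be the even reduction of the simplest generalized Jacobi weight, with x_0 = cos θ_0, θ_0 ∈ (0,π), λ = log(B/A)/(2π). Let φ̃_n be the orthonormal polynomials on the unit circle for the weight θ ↦ w̃(cos θ)|sin θ| on [−π,π], i.e. ∫_{−π}^{π} φ̃_m(e^{iθ}) conj(φ̃_n(e^{iθ})) w̃(cos θ)|sin θ| dθ = δ_{mn}, with positive leading coefficient κ̃_n; since the weight is invariant under θ ↦ θ+π, write φ̃_n(z) = κ̃_n z^n + κ̃'_n z^{n−2} + κ̃''_n z^{n−4} + ⋯. Then κ̃'_n/κ̃_n → α − β + γ x_0 + 2λ sin θ_0 and κ̃''_n/κ̃_n → (α−β)²/2 + (α+β+1)/2 + (α−β)(γ x_0 + 2λ sin θ_0) + (γ(γ+2)/4 − λ²) cos 2θ_0 + λ(γ+1) sin 2θ_0 + γ²/4 + λ² as n → ∞. -/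
open MeasureTheory

section Szego

open Filter Topology Set

/-- Two-sided control of the modulus of a complex power with `0 ≤ re a` of `1 - r v`, uniformly
in the dilation parameter `r ∈ [0, 1]` and `v` on the unit circle. -/
lemma exists_norm_sq_one_sub_cpow_le (a : ℂ) (ha : 0 ≤ a.re) :
    ∃ C : ℝ, 0 < C ∧ ∀ r ∈ Icc (0 : ℝ) 1, ∀ v : ℂ, ‖v‖ = 1 → v ≠ 1 →
      ‖(1 - r * v) ^ a‖ ^ 2 ≤ C ∧ ‖(1 - v) ^ a‖ ^ 2 ≤ C * ‖(1 - r * v) ^ a‖ ^ 2 := by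
  set E := Real.exp (Real.pi * |a.im|) with hE
  have hE1 : 1 ≤ E := Real.one_le_exp (by positivity)
  have hE0 : 0 < E := by positivity
  have upper : ∀ x : ℂ, x ≠ 0 → ‖x ^ a‖ ≤ ‖x‖ ^ a.re * E := by
    intro x hx
    rw [Complex.norm_cpow_of_ne_zero hx, div_eq_mul_inv, ← Real.exp_neg]
    gcongr
    rw [hE]
    gcongr
    calc -(x.arg * a.im) ≤ |x.arg * a.im| := neg_le_abs _
      _ = |x.arg| * |a.im| := abs_mul _ _
      _ ≤ _ := by gcongr; exact Complex.abs_arg_le_pi x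
  have lower : ∀ x : ℂ, x ≠ 0 → ‖x‖ ^ a.re ≤ E * ‖x ^ a‖ := by
    intro x hx
    rw [Complex.norm_cpow_of_ne_zero hx, ← mul_div_assoc, le_div_iff₀ (Real.exp_pos _), mul_comm]
    refine mul_le_mul_of_nonneg_right (Real.exp_le_exp.2 ?_) (by positivity)
    calc (x.arg * a.im) ≤ |x.arg * a.im| := le_abs_self _
      _ = |x.arg| * |a.im| := abs_mul _ _
      _ ≤ _ := by gcongr; exact Complex.abs_arg_le_pi x
  set K := (2 : ℝ) ^ a.re * E * E with hK
  have hK0 : 0 < K := by positivity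
  refine ⟨K ^ 2, by positivity, fun r hr v hv hv1 => ?_⟩
  have hne : (1 : ℂ) - r * v ≠ 0 := by
    intro h
    have h1 : (r : ℂ) * v = 1 := (sub_eq_zero.1 h).symm
    have h2 : r = 1 := by
      have := congrArg norm h1
      rw [norm_mul, hv, Complex.norm_real, Real.norm_of_nonneg hr.1] at this
      simpa using this
    rw [h2] at h1
    exact hv1 (by simpa using h1)
  have hrv : ‖(r : ℂ) * v‖ = r := by
    rw [norm_mul, hv, Complex.norm_real, Real.norm_of_nonneg hr.1, mul_one]
  have h2 : ‖(1 : ℂ) - r * v‖ ≤ 2 := by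
    calc _ ≤ ‖(1 : ℂ)‖ + ‖(r : ℂ) * v‖ := norm_sub_le _ _
      _ ≤ 2 := by rw [hrv, norm_one]; linarith [hr.2]
  have h3 : 1 - r ≤ ‖(1 : ℂ) - r * v‖ := by
    have := norm_sub_norm_le (1 : ℂ) (r * v)
    rwa [hrv, norm_one] at this
  have h4 : ‖1 - v‖ ≤ 2 * ‖(1 : ℂ) - r * v‖ := by
    have h5 : (1 : ℂ) - v = (1 - r * v) - ((1 - r : ℝ) : ℂ) * v := by push_cast; ring
    have h6 : ‖((1 - r : ℝ) : ℂ) * v‖ = 1 - r := by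
      rw [norm_mul, hv, Complex.norm_real, Real.norm_of_nonneg (by linarith [hr.2]), mul_one]
    rw [h5]
    refine (norm_sub_le _ _).trans ?_
    rw [h6]; linarith
  constructor
  · gcongr
    calc _ ≤ _ := upper _ hne
      _ ≤ 2 ^ a.re * E * 1 := by rw [mul_one]; gcongr
      _ ≤ K := by rw [hK]; gcongr
  · rw [← mul_pow]
    gcongr
    calc _ ≤ _ := upper _ (sub_ne_zero.2 hv1.symm)
      _ ≤ (2 * ‖(1 : ℂ) - r * v‖) ^ a.re * E := by gcongr
      _ = 2 ^ a.re * E * ‖(1 : ℂ) - r * v‖ ^ a.re := by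
        rw [Real.mul_rpow (by norm_num) (norm_nonneg _)]; ring
      _ ≤ 2 ^ a.re * E * (E * ‖(1 - (r : ℂ) * v) ^ a‖) := by gcongr; exact lower _ hne
      _ = _ := by rw [hK]; ring

/-- A function holomorphic near the closed unit disc satisfies the sub-mean value inequality
for the square of its modulus. -/
lemma two_pi_mul_norm_sq_le_integral {f : ℂ → ℂ} {R : ℝ} (hR : 1 < R)
    (hf : DifferentiableOn ℂ f (Metric.ball 0 R)) :
    2 * Real.pi * ‖f 0‖ ^ 2 ≤
      ∫ θ in Ioo (-Real.pi) Real.pi, ‖f (Complex.exp (-(Complex.I * θ)))‖ ^ 2 := by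
  have hpi := Real.pi_pos
  have hsub : Metric.closedBall (0 : ℂ) 1 ⊆ Metric.ball 0 R := Metric.closedBall_subset_ball hR
  have h1 : Real.circleAverage (fun z => f z ^ 2) 0 1 = f 0 ^ 2 := by
    refine DiffContOnCl.circleAverage (f := fun z => f z ^ 2) ?_
    rw [abs_one]
    refine DifferentiableOn.diffContOnCl ?_
    rw [closure_ball _ one_ne_zero]
    exact (hf.mono hsub).pow 2
  rw [Real.circleAverage_def] at h1
  have h2 : 2 * Real.pi * ‖f 0‖ ^ 2 ≤ ∫ θ in 0..2 * Real.pi, ‖f (circleMap 0 1 θ)‖ ^ 2 := by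
    rw [← norm_pow, ← h1, norm_smul, norm_inv, Real.norm_of_nonneg (by positivity),
      mul_inv_cancel_left₀ (by positivity)]
    refine (intervalIntegral.norm_integral_le_integral_norm (by positivity)).trans (le_of_eq ?_)
    simp only [norm_pow]
  refine h2.trans (le_of_eq ?_)
  have hper : Function.Periodic (fun θ => ‖f (circleMap 0 1 θ)‖ ^ 2) (2 * Real.pi) := by
    intro θ
    simp only [periodic_circleMap 0 1 θ]
  have h3 := hper.intervalIntegral_add_eq 0 (-Real.pi)
  rw [zero_add, show -Real.pi + 2 * Real.pi = Real.pi by ring] at h3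
  rw [h3, ← integral_Ioc_eq_integral_Ioo, ← intervalIntegral.integral_of_le (by linarith)]
  have h4 := intervalIntegral.integral_comp_neg (a := -Real.pi) (b := Real.pi)
    (fun θ => ‖f (circleMap 0 1 θ)‖ ^ 2)
  rw [neg_neg] at h4
  rw [← h4]
  simp [circleMap, mul_comm]

/-- Taylor polynomials of `∏ (1 - s j u) ^ (-a j)` approximate it uniformly on the unit disc. -/
lemma exists_polynomial_approx_prod_cpow {ι : Type*} (S : Finset ι) (a s : ι → ℂ) (ρ : ℝ)
    (hρ : ρ < 1) (hs : ∀ j ∈ S, ‖s j‖ ≤ ρ) (ε : ℝ) (hε : 0 < ε) :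
    ∃ T : Polynomial ℂ, T.coeff 0 = 1 ∧ T.coeff 1 = ∑ j ∈ S, a j * s j ∧
      T.coeff 2 = ((∑ j ∈ S, a j * s j) ^ 2 + ∑ j ∈ S, a j * s j ^ 2) / 2 ∧
      ∀ u : ℂ, ‖u‖ ≤ 1 → ‖T.eval u - ∏ j ∈ S, (1 - s j * u) ^ (-a j)‖ ≤ ε := by
  obtain ⟨R, hR1, hRρ⟩ : ∃ R : ℝ, 1 < R ∧ ρ * R < 1 := by
    rcases le_or_gt ρ 0 with h | h
    · exact ⟨2, by norm_num, by linarith⟩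
    · refine ⟨(1 + ρ⁻¹) / 2, ?_, ?_⟩
      · have := (one_lt_inv₀ h).2 hρ; linarith
      · field_simp; linarith
  have hR0 : 0 < R := by linarith
  have hslit : ∀ j ∈ S, ∀ u : ℂ, ‖u‖ ≤ R → 1 - s j * u ∈ Complex.slitPlane := by
    intro j hj u hu
    left
    have h1 : (s j * u).re ≤ ρ * R :=
      (Complex.re_le_norm _).trans ((norm_mul _ _).le.trans
        (mul_le_mul (hs j hj) hu (norm_nonneg _) ((norm_nonneg _).trans (hs j hj))))
    simp only [Complex.sub_re, Complex.one_re]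
    linarith
  set H : ℂ → ℂ := fun u => ∏ j ∈ S, (1 - s j * u) ^ (-a j) with hH
  set L : ℂ → ℂ := fun u => ∑ j ∈ S, a j * s j / (1 - s j * u) with hL
  have hder : ∀ u : ℂ, ‖u‖ ≤ R → HasDerivAt H (L u * H u) u := by
    intro u hu
    have hfac : ∀ j ∈ S, HasDerivAt (fun u => (1 - s j * u) ^ (-a j))
        (a j * s j / (1 - s j * u) * (1 - s j * u) ^ (-a j)) u := by
      intro j hj
      have hne := Complex.slitPlane_ne_zero (hslit j hj u hu)
      have h0 : HasDerivAt (fun u => 1 - s j * u) (-s j) u := by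
        simpa using ((hasDerivAt_id u).const_mul (s j)).const_sub 1
      convert h0.cpow_const (c := -a j) (hslit j hj u hu) using 1
      rw [Complex.cpow_sub _ _ hne, Complex.cpow_one]
      field_simp
    classical
    refine (HasDerivAt.fun_finsetProd hfac).congr_deriv ?_
    simp only [hL, hH, Finset.sum_mul]
    refine Finset.sum_congr rfl fun j hj => ?_
    rw [← Finset.mul_prod_erase S _ hj, smul_eq_mul]
    ring
  have hdiff : DifferentiableOn ℂ H (Metric.closedBall 0 R) := fun u hu =>
    (hder u (by simpa using hu)).differentiableAt.differentiableWithinAt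
  lift R to NNReal using hR0.le
  have hps := DifferentiableOn.hasFPowerSeriesOnBall hdiff (by exact_mod_cast hR0)
  set p := cauchyPowerSeries H 0 R with hp
  obtain ⟨r', hr1, hrR⟩ := exists_between (show (1 : NNReal) < R by exact_mod_cast hR1)
  have hunif := hps.tendstoUniformlyOn' (r' := r') (by exact_mod_cast hrR)
  have hev := Metric.tendstoUniformlyOn_iff.1 hunif ε hε
  obtain ⟨N, hN, hN3⟩ := (hev.and (eventually_ge_atTop 3)).exists
  have hH0 : H 0 = 1 := by simp [hH]
  have hL0 : L 0 = ∑ j ∈ S, a j * s j := by simp [hL]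
  have hc : ∀ n, (Nat.factorial n : ℂ) * p.coeff n = iteratedDeriv n H 0 := by
    intro n
    have := hps.factorial_smul 1 n
    rw [iteratedDeriv_eq_iteratedFDeriv]
    rw [nsmul_eq_mul] at this
    exact this
  have hc0 : p.coeff 0 = 1 := by simpa [hH0] using hc 0
  have hc1 : p.coeff 1 = L 0 := by
    have := hc 1
    rw [iteratedDeriv_one, (hder 0 (by simp)).deriv] at this
    simpa [hH0] using this
  have hLder : HasDerivAt L (∑ j ∈ S, a j * s j ^ 2) 0 := by
    refine HasDerivAt.fun_sum fun j hj => ?_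
    have h0 : HasDerivAt (fun u => 1 - s j * u) (-s j) 0 := by
      simpa using ((hasDerivAt_id (0 : ℂ)).const_mul (s j)).const_sub 1
    refine ((h0.fun_inv (by simp)).const_mul (a j * s j)).congr_deriv ?_
    simp
    ring
  have hc2 : p.coeff 2 = (L 0 ^ 2 + ∑ j ∈ S, a j * s j ^ 2) / 2 := by
    have := hc 2
    have heq : deriv H =ᶠ[𝓝 0] fun u => L u * H u := by
      filter_upwards [Metric.closedBall_mem_nhds (0 : ℂ) hR0] with u hu
      exact (hder u (by simpa using hu)).deriv
    rw [iteratedDeriv_succ, iteratedDeriv_one, heq.deriv_eq,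
      (hLder.fun_mul (hder 0 (by simp))).deriv, hH0] at this
    rw [eq_div_iff two_ne_zero]
    norm_num [Nat.factorial] at this
    linear_combination this
  refine ⟨∑ k ∈ Finset.range N, Polynomial.monomial k (p.coeff k), ?_, ?_, ?_, ?_⟩
  · simp [Polynomial.coeff_monomial, hc0]; omega
  · simp [Polynomial.coeff_monomial, hc1, hL0]; omega
  · simp [Polynomial.coeff_monomial, hc2, hL0]; omega
  · intro u hu
    have h := hN u (by
      rw [Metric.mem_ball, dist_zero_right]; exact hu.trans_lt (by exact_mod_cast hr1))
    rw [dist_comm, dist_eq_norm, sub_zero] at h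
    refine le_of_eq_of_le ?_ h.le
    congr 2
    simp [FormalMultilinearSeries.partialSum, Polynomial.eval_finsetSum, mul_comm]

lemma one_sub_mem_slitPlane {w : ℂ} (hw : ‖w‖ ≤ 1) (hw1 : w ≠ 1) : 1 - w ∈ Complex.slitPlane := by
  left
  have h := (Complex.re_le_norm w).trans hw
  rcases h.lt_or_eq with h | h
  · simpa using h
  · exfalso
    have h2 : Complex.normSq w ≤ 1 := by
      rw [Complex.normSq_eq_norm_sq]
      exact pow_le_one₀ (norm_nonneg _) hw
    rw [Complex.normSq_apply, h] at h2
    have h3 : w.im = 0 := by nlinarith [mul_self_nonneg w.im]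
    exact hw1 (Complex.ext (by simpa using h) (by simpa using h3))

/-- The squared modulus of the dilated product `∏ (1 - r ζ j v) ^ a j`. -/
noncomputable def prodNormSq {ι : Type*} (S : Finset ι) (a ζ : ι → ℂ) (r : ℝ) (v : ℂ) : ℝ :=
  ∏ j ∈ S, ‖(1 - r * (ζ j * v)) ^ a j‖ ^ 2

section prodNormSq

variable {ι : Type*} {S : Finset ι} {a ζ : ι → ℂ}

lemma prodNormSq_nonneg (r : ℝ) (v : ℂ) : 0 ≤ prodNormSq S a ζ r v :=
  Finset.prod_nonneg fun _ _ => by positivity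

lemma prodNormSq_neg (r : ℝ) (v : ℂ) :
    prodNormSq S (fun j => -a j) ζ r v = (prodNormSq S a ζ r v)⁻¹ := by
  simp [prodNormSq, Complex.cpow_neg, Finset.prod_inv_distrib]

lemma one_sub_dilation_mem_slitPlane {w : ℂ} {r : ℝ} (hr : r ∈ Icc (0 : ℝ) 1) (hw : ‖w‖ = 1)
    (hw1 : w ≠ 1) : 1 - r * w ∈ Complex.slitPlane := by
  have hn : ‖(r : ℂ) * w‖ = r := by
    rw [norm_mul, hw, Complex.norm_real, Real.norm_of_nonneg hr.1, mul_one]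
  refine one_sub_mem_slitPlane (hn.le.trans hr.2) fun h => hw1 ?_
  have : r = 1 := by rw [← hn, h, norm_one]
  simpa [this] using h

lemma prodNormSq_pos (hζ : ∀ j ∈ S, ‖ζ j‖ = 1) {r : ℝ} (hr : r ∈ Icc (0 : ℝ) 1) {v : ℂ}
    (hv : ‖v‖ = 1) (hbad : ∀ j ∈ S, ζ j * v ≠ 1) : 0 < prodNormSq S a ζ r v := by
  refine Finset.prod_pos fun j hj => ?_
  have hne := Complex.slitPlane_ne_zero
    (one_sub_dilation_mem_slitPlane hr (by rw [norm_mul, hζ j hj, hv, one_mul]) (hbad j hj))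
  have : (1 - r * (ζ j * v)) ^ a j ≠ 0 := by simp [Complex.cpow_eq_zero_iff, hne]
  positivity

lemma exists_prodNormSq_le (ha : ∀ j ∈ S, 0 ≤ (a j).re) (hζ : ∀ j ∈ S, ‖ζ j‖ = 1) :
    ∃ C : ℝ, 0 < C ∧ ∀ r ∈ Icc (0 : ℝ) 1, ∀ v : ℂ, ‖v‖ = 1 → (∀ j ∈ S, ζ j * v ≠ 1) →
      prodNormSq S a ζ r v ≤ C ∧ prodNormSq S a ζ 1 v ≤ C * prodNormSq S a ζ r v := by
  choose! C hC hC' using fun j (hj : j ∈ S) => exists_norm_sq_one_sub_cpow_le (a j) (ha j hj)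
  refine ⟨∏ j ∈ S, C j, Finset.prod_pos hC, fun r hr v hv hbad => ⟨?_, ?_⟩⟩
  · refine Finset.prod_le_prod (fun _ _ => by positivity) fun j hj => ?_
    exact (hC' j hj r hr _ (by rw [norm_mul, hζ j hj, hv, one_mul]) (hbad j hj)).1
  · rw [prodNormSq, prodNormSq, ← Finset.prod_mul_distrib]
    refine Finset.prod_le_prod (fun _ _ => by positivity) fun j hj => ?_
    have := (hC' j hj r hr _ (by rw [norm_mul, hζ j hj, hv, one_mul]) (hbad j hj)).2
    simpa using this

lemma tendsto_prodNormSq (hζ : ∀ j ∈ S, ‖ζ j‖ = 1) {v : ℂ}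
    (hv : ‖v‖ = 1) (hbad : ∀ j ∈ S, ζ j * v ≠ 1) :
    Tendsto (fun r => prodNormSq S a ζ r v) (𝓝[<] 1) (𝓝 (prodNormSq S a ζ 1 v)) := by
  refine Tendsto.mono_left ?_ nhdsWithin_le_nhds
  refine tendsto_finsetProd _ fun j hj => ?_
  have hs := one_sub_dilation_mem_slitPlane (r := 1) (by simp)
    (show ‖ζ j * v‖ = 1 by rw [norm_mul, hζ j hj, hv, one_mul]) (hbad j hj)
  have h1 : ContinuousAt (fun r : ℝ => (1 : ℂ) - r * (ζ j * v)) 1 := by fun_prop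
  have h2 := h1.cpow (continuousAt_const (y := a j)) hs
  exact (h2.norm.pow 2).tendsto

lemma exists_prodNormSq_le_of_lt_one (hζ : ∀ j ∈ S, ‖ζ j‖ = 1) {r : ℝ} (hr : r ∈ Ico (0 : ℝ) 1) :
    ∃ M : ℝ, ∀ v : ℂ, ‖v‖ ≤ 1 → prodNormSq S a ζ r v ≤ M := by
  have hc : ContinuousOn (fun v => prodNormSq S a ζ r v) (Metric.closedBall 0 1) := by
    refine continuousOn_finsetProd _ fun j hj => ContinuousOn.pow (ContinuousOn.norm ?_) 2
    refine ContinuousOn.cpow (by fun_prop) continuousOn_const fun v hv => ?_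
    have hv : ‖v‖ ≤ 1 := by simpa using hv
    have hn : ‖(r : ℂ) * (ζ j * v)‖ < 1 := by
      rw [norm_mul, norm_mul, hζ j hj, Complex.norm_real, Real.norm_of_nonneg hr.1, one_mul]
      exact (mul_le_of_le_one_right hr.1 hv).trans_lt hr.2
    refine one_sub_mem_slitPlane hn.le fun h => ?_
    rw [h, norm_one] at hn
    exact lt_irrefl _ hn
  obtain ⟨M, hM⟩ := (isCompact_closedBall (0 : ℂ) 1).bddAbove_image hc
  exact ⟨M, fun v hv => hM (mem_image_of_mem _ (by simpa using hv))⟩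

end prodNormSq

/-- A pair of families of dilated moduli: `p r` is bounded and dominates `p 1`, `q r` is bounded
below and dominated by `q 1`, with pointwise convergence as `r → 1`. -/
structure IsDilationPair (ν : Measure ℝ) (p q : ℝ → ℝ → ℝ) (C : ℝ) : Prop where
  measurable_left : ∀ r, Measurable (p r)
  measurable_right : ∀ r, Measurable (q r)
  left_le : ∀ᵐ θ ∂ν, ∀ r ∈ Icc (0 : ℝ) 1, 0 < p r θ ∧ p r θ ≤ C ∧ p 1 θ ≤ C * p r θ
  right_le : ∀ᵐ θ ∂ν, ∀ r ∈ Icc (0 : ℝ) 1, 0 < q r θ ∧ (q r θ)⁻¹ ≤ C ∧ q r θ ≤ C * q 1 θ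
  tendsto_left : ∀ᵐ θ ∂ν, Tendsto (fun r => p r θ) (𝓝[<] 1) (𝓝 (p 1 θ))
  tendsto_right : ∀ᵐ θ ∂ν, Tendsto (fun r => q r θ) (𝓝[<] 1) (𝓝 (q 1 θ))
  bound_left : ∀ r ∈ Ico (0 : ℝ) 1, ∃ M, ∀ θ, (p r θ)⁻¹ ≤ M
  bound_right : ∀ r ∈ Ico (0 : ℝ) 1, ∃ M, ∀ θ, q r θ ≤ M

namespace IsDilationPair

variable {ν : Measure ℝ} [IsFiniteMeasure ν] {p q : ℝ → ℝ → ℝ} {C : ℝ}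

lemma le_integral (h : IsDilationPair ν p q C) (hC : 0 < C)
    (hI : Integrable (fun θ => p 1 θ * q 1 θ) ν)
    {f : ℝ → ℝ} {M K : ℝ} (hfm : Measurable f) (hf0 : ∀ θ, 0 ≤ f θ) (hfM : ∀ θ, f θ ≤ M)
    (hK : ∀ r ∈ Ioo (0 : ℝ) 1, ∀ r' ∈ Ioo (0 : ℝ) 1, K ≤ ∫ θ, f θ * (p r θ * q r' θ) ∂ν) :
    K ≤ ∫ θ, f θ * (p 1 θ * q 1 θ) ∂ν := by
  have hM : 0 ≤ M := (hf0 0).trans (hfM 0)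
  have hev : ∀ᶠ r in 𝓝[<] (1 : ℝ), r ∈ Ioo (0 : ℝ) 1 := Ioo_mem_nhdsLT one_pos
  have hpm := h.measurable_left
  have hqm := h.measurable_right
  have inner : ∀ r' ∈ Ioo (0 : ℝ) 1, K ≤ ∫ θ, f θ * (p 1 θ * q r' θ) ∂ν := by
    intro r' hr'
    obtain ⟨Q, hQ⟩ := h.bound_right r' ⟨hr'.1.le, hr'.2⟩
    have ht : Tendsto (fun r => ∫ θ, f θ * (p r θ * q r' θ) ∂ν) (𝓝[<] 1)
        (𝓝 (∫ θ, f θ * (p 1 θ * q r' θ) ∂ν)) := by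
      refine tendsto_integral_filter_of_dominated_convergence (fun _ => M * (C * Q))
        (.of_forall fun r => by fun_prop) ?_ (integrable_const _) ?_
      · filter_upwards [hev] with r hr
        filter_upwards [h.left_le, h.right_le] with θ h1 h2
        have h1 := h1 r ⟨hr.1.le, hr.2.le⟩
        have h2 := h2 r' ⟨hr'.1.le, hr'.2.le⟩
        rw [Real.norm_of_nonneg (mul_nonneg (hf0 θ) (mul_nonneg h1.1.le h2.1.le))]
        exact mul_le_mul (hfM θ) (mul_le_mul h1.2.1 (hQ θ) h2.1.le hC.le)
          (mul_nonneg h1.1.le h2.1.le) hM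
      · filter_upwards [h.tendsto_left] with θ h1
        exact (h1.mul_const _).const_mul _
    exact ge_of_tendsto ht (by filter_upwards [hev] with r hr using hK r hr r' hr')
  have ht : Tendsto (fun r' => ∫ θ, f θ * (p 1 θ * q r' θ) ∂ν) (𝓝[<] 1)
      (𝓝 (∫ θ, f θ * (p 1 θ * q 1 θ) ∂ν)) := by
    refine tendsto_integral_filter_of_dominated_convergence
      (fun θ => M * C * (p 1 θ * q 1 θ))
      (.of_forall fun r => by fun_prop) ?_ (hI.const_mul _) ?_
    · filter_upwards [hev] with r hr
      filter_upwards [h.left_le, h.right_le] with θ h1 h2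
      have h1 := h1 1 (by simp)
      have h2 := h2 r ⟨hr.1.le, hr.2.le⟩
      rw [Real.norm_of_nonneg (mul_nonneg (hf0 θ) (mul_nonneg h1.1.le h2.1.le))]
      calc f θ * (p 1 θ * q r θ) ≤ M * (p 1 θ * (C * q 1 θ)) :=
            mul_le_mul (hfM θ) (mul_le_mul_of_nonneg_left h2.2.2 h1.1.le)
              (mul_nonneg h1.1.le h2.1.le) hM
        _ = _ := by ring
    · filter_upwards [h.tendsto_right] with θ h1
      exact (h1.const_mul _).const_mul _
  exact ge_of_tendsto ht (by filter_upwards [hev] with r hr using inner r hr)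

lemma eventually_integral_lt (h : IsDilationPair ν p q C)
    (hI : Integrable (fun θ => p 1 θ * q 1 θ) ν) {K : ℝ} (hK : ν.real univ < K) :
    ∀ᶠ r in 𝓝[<] (1 : ℝ), ∀ᶠ r' in 𝓝[<] (1 : ℝ),
      ∫ θ, (p r θ * q r' θ)⁻¹ * (p 1 θ * q 1 θ) ∂ν < K := by
  have hev : ∀ᶠ r in 𝓝[<] (1 : ℝ), r ∈ Ioo (0 : ℝ) 1 := Ioo_mem_nhdsLT one_pos
  have hpm := h.measurable_left
  have hqm := h.measurable_right
  have inner : ∀ r ∈ Ioo (0 : ℝ) 1,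
      Tendsto (fun r' => ∫ θ, (p r θ * q r' θ)⁻¹ * (p 1 θ * q 1 θ) ∂ν) (𝓝[<] 1)
        (𝓝 (∫ θ, (p r θ)⁻¹ * p 1 θ ∂ν)) := by
    intro r hr
    obtain ⟨Q, hQ⟩ := h.bound_left r ⟨hr.1.le, hr.2⟩
    refine tendsto_integral_filter_of_dominated_convergence
      (fun θ => Q * C * (p 1 θ * q 1 θ))
      (.of_forall fun r => by fun_prop) ?_ (hI.const_mul _) ?_
    · filter_upwards [hev] with r' hr'
      filter_upwards [h.left_le, h.right_le] with θ h1 h2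
      have h1' := h1 r ⟨hr.1.le, hr.2.le⟩
      have h2' := h2 r' ⟨hr'.1.le, hr'.2.le⟩
      have h3 := (h1 1 (by simp)).1
      have h4 := (h2 1 (by simp)).1
      have h5 := h1'.1
      have h6 := h2'.1
      rw [Real.norm_of_nonneg (by positivity), mul_inv]
      exact mul_le_mul_of_nonneg_right (mul_le_mul (hQ θ) h2'.2.1 (by positivity)
        ((inv_nonneg.2 h5.le).trans (hQ θ))) (by positivity)
    · filter_upwards [h.left_le, h.right_le, h.tendsto_right] with θ h1 h2 h3
      have h4 := (h1 r ⟨hr.1.le, hr.2.le⟩).1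
      have h5 := (h2 1 (by simp)).1
      have h6 := ((h3.const_mul (p r θ)).inv₀ (by positivity)).mul_const (p 1 θ * q 1 θ)
      convert h6 using 2
      field_simp
  have outer : Tendsto (fun r => ∫ θ, (p r θ)⁻¹ * p 1 θ ∂ν) (𝓝[<] 1) (𝓝 (ν.real univ)) := by
    have h0 : ν.real univ = ∫ _, (1 : ℝ) ∂ν := by simp
    rw [h0]
    refine tendsto_integral_filter_of_dominated_convergence (fun _ => C)
      (.of_forall fun r => by fun_prop) ?_ (integrable_const _) ?_
    · filter_upwards [hev] with r hr
      filter_upwards [h.left_le] with θ h1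
      have h2 := h1 r ⟨hr.1.le, hr.2.le⟩
      have h3 := h2.1
      have h4 := (h1 1 (by simp)).1
      rw [Real.norm_of_nonneg (by positivity), inv_mul_le_iff₀ h3, mul_comm]
      exact h2.2.2
    · filter_upwards [h.left_le, h.tendsto_left] with θ h1 h2
      have h4 := (h1 1 (by simp)).1
      have h6 := (h2.inv₀ h4.ne').mul_const (p 1 θ)
      rwa [inv_mul_cancel₀ h4.ne'] at h6
  filter_upwards [hev, outer.eventually_lt_const hK] with r hr hr'
  exact (inner r hr).eventually_lt_const hr'

end IsDilationPair

lemma ae_mul_exp_sq_ne_one (w : ℂ) :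
    ∀ᵐ θ : ℝ, w * Complex.exp (-(Complex.I * θ)) ^ 2 ≠ 1 := by
  have hcount : {θ : ℝ | w * Complex.exp (-(Complex.I * θ)) ^ 2 = 1}.Countable := by
    rcases Set.eq_empty_or_nonempty {θ : ℝ | w * Complex.exp (-(Complex.I * θ)) ^ 2 = 1} with h | h
    · rw [h]; exact countable_empty
    · obtain ⟨θ₁, h₁⟩ := h
      refine (countable_range fun n : ℤ => θ₁ - n * Real.pi).mono fun θ hθ => ?_
      simp only [mem_ofPred_eq] at h₁ hθ
      have hw : w ≠ 0 := by rintro rfl; simp at h₁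
      have h2 : Complex.exp (2 * (-(Complex.I * θ))) = Complex.exp (2 * (-(Complex.I * θ₁))) := by
        have := mul_left_cancel₀ hw (hθ.trans h₁.symm)
        rwa [← Complex.exp_nat_mul, ← Complex.exp_nat_mul] at this
      obtain ⟨n, hn⟩ := Complex.exp_eq_exp_iff_exists_int.1 h2
      refine ⟨n, ?_⟩
      have h3 : (2 * Complex.I) * ((θ₁ - n * Real.pi : ℝ) : ℂ) = (2 * Complex.I) * θ := by
        push_cast
        linear_combination hn
      exact_mod_cast mul_left_cancel₀ (by simp) h3
  exact hcount.ae_notMem _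

lemma norm_exp_neg_I_mul (θ : ℝ) : ‖Complex.exp (-(Complex.I * θ))‖ = 1 := by
  rw [show -(Complex.I * (θ : ℂ)) = ((-θ : ℝ) : ℂ) * Complex.I by push_cast; ring]
  exact Complex.norm_exp_ofReal_mul_I _

section weight

variable {ι : Type*} [Fintype ι] {a ζ : ι → ℂ}

open Classical in
lemma exists_isDilationPair (hζ : ∀ j, ‖ζ j‖ = 1) :
    ∃ C : ℝ, 0 < C ∧ IsDilationPair (volume.restrict (Ioo (-Real.pi) Real.pi))
      (fun r θ => prodNormSq {j | 0 < (a j).re} a ζ r (Complex.exp (-(Complex.I * θ)) ^ 2))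
      (fun r θ => prodNormSq {j | ¬ 0 < (a j).re} a ζ r (Complex.exp (-(Complex.I * θ)) ^ 2)) C := by
  have hv : ∀ θ : ℝ, ‖Complex.exp (-(Complex.I * θ)) ^ 2‖ = 1 := fun θ => by
    rw [norm_pow, norm_exp_neg_I_mul, one_pow]
  obtain ⟨C₁, hC₁, h₁⟩ := exists_prodNormSq_le (S := {j | 0 < (a j).re}) (a := a) (ζ := ζ)
    (fun j hj => (Finset.mem_filter.1 hj).2.le) (fun j _ => hζ j)
  obtain ⟨C₂, hC₂, h₂⟩ := exists_prodNormSq_le (S := {j | ¬ 0 < (a j).re}) (a := fun j => -a j)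
    (ζ := ζ) (fun j hj => by simpa using (Finset.mem_filter.1 hj).2) (fun j _ => hζ j)
  have hbad : ∀ᵐ θ : ℝ ∂(volume.restrict (Ioo (-Real.pi) Real.pi)),
      ∀ j, ζ j * Complex.exp (-(Complex.I * θ)) ^ 2 ≠ 1 :=
    ae_restrict_of_ae (ae_all_iff.2 fun j => ae_mul_exp_sq_ne_one (ζ j))
  refine ⟨C₁ + C₂, by positivity, ?_, ?_, ?_, ?_, ?_, ?_, ?_, ?_⟩
  · intro r; unfold prodNormSq; fun_prop
  · intro r; unfold prodNormSq; fun_prop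
  · filter_upwards [hbad] with θ hθ r hr
    have h := h₁ r hr _ (hv θ) fun j _ => hθ j
    have hpos := prodNormSq_pos (S := {j | 0 < (a j).re}) (a := a) (fun j _ => hζ j) hr (hv θ)
      fun j _ => hθ j
    exact ⟨hpos, by linarith, h.2.trans (by gcongr; linarith)⟩
  · filter_upwards [hbad] with θ hθ r hr
    have h := h₂ r hr _ (hv θ) fun j _ => hθ j
    have hpos := prodNormSq_pos (S := {j | ¬ 0 < (a j).re}) (a := a) (fun j _ => hζ j) hr (hv θ)
      fun j _ => hθ j
    have hpos1 := prodNormSq_pos (S := {j | ¬ 0 < (a j).re}) (a := a) (r := 1) (fun j _ => hζ j)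
      (by simp) (hv θ) fun j _ => hθ j
    rw [prodNormSq_neg, prodNormSq_neg] at h
    refine ⟨hpos, by linarith, ?_⟩
    have h3 := h.2
    rw [inv_le_iff_one_le_mul₀ hpos1, mul_right_comm, ← div_eq_mul_inv, one_le_div hpos] at h3
    exact h3.trans (by gcongr; linarith)
  · filter_upwards [hbad] with θ hθ
    exact tendsto_prodNormSq (fun j _ => hζ j) (hv θ) fun j _ => hθ j
  · filter_upwards [hbad] with θ hθ
    exact tendsto_prodNormSq (fun j _ => hζ j) (hv θ) fun j _ => hθ j
  · intro r hr
    obtain ⟨M, hM⟩ := exists_prodNormSq_le_of_lt_one (S := {j | 0 < (a j).re})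
      (a := fun j => -a j) (ζ := ζ) (fun j _ => hζ j) hr
    exact ⟨M, fun θ => by simpa only [prodNormSq_neg] using hM _ (hv θ).le⟩
  · intro r hr
    obtain ⟨M, hM⟩ := exists_prodNormSq_le_of_lt_one (S := {j | ¬ 0 < (a j).re})
      (a := a) (ζ := ζ) (fun j _ => hζ j) hr
    exact ⟨M, fun θ => hM _ (hv θ).le⟩

open Classical in
lemma prodNormSq_filter_mul (r r' : ℝ) (v : ℂ) :
    prodNormSq {j | 0 < (a j).re} a ζ r v * prodNormSq {j | ¬ 0 < (a j).re} a ζ r' v =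
      ‖∏ j, (1 - ((if 0 < (a j).re then r else r' : ℝ) * ζ j) * v) ^ a j‖ ^ 2 := by
  rw [norm_prod, ← Finset.prod_pow,
    ← Finset.prod_filter_mul_prod_filter_not Finset.univ (fun j => 0 < (a j).re)]
  congr 1
  · refine Finset.prod_congr rfl fun j hj => ?_
    rw [if_pos (Finset.mem_filter.1 hj).2, mul_assoc]
  · refine Finset.prod_congr rfl fun j hj => ?_
    rw [if_neg (Finset.mem_filter.1 hj).2, mul_assoc]

open Classical in
lemma prodNormSq_filter_mul_self (r : ℝ) (v : ℂ) :
    prodNormSq {j | 0 < (a j).re} a ζ r v * prodNormSq {j | ¬ 0 < (a j).re} a ζ r v =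
      prodNormSq Finset.univ a ζ r v :=
  Finset.prod_filter_mul_prod_filter_not Finset.univ _ _

lemma continuous_norm_sq_eval_exp (P : Polynomial ℂ) :
    Continuous fun θ : ℝ => ‖P.eval (Complex.exp (-(Complex.I * θ)))‖ ^ 2 := by
  have := P.continuous
  fun_prop

lemma exists_norm_sq_eval_exp_le (P : Polynomial ℂ) :
    ∃ M, ∀ θ : ℝ, ‖P.eval (Complex.exp (-(Complex.I * θ)))‖ ^ 2 ≤ M := by
  obtain ⟨M, hM⟩ := (isCompact_closedBall (0 : ℂ) 1).bddAbove_image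
    (f := fun z => ‖P.eval z‖ ^ 2) (P.continuous.norm.pow 2).continuousOn
  exact ⟨M, fun θ => hM (mem_image_of_mem _ (by simp [norm_exp_neg_I_mul]))⟩

/-- Szegő's lower bound for the weighted norm of a polynomial by its constant coefficient. -/
lemma two_pi_mul_norm_sq_coeff_zero_le (hζ : ∀ j, ‖ζ j‖ = 1)
    (hI : IntegrableOn (fun θ : ℝ => prodNormSq Finset.univ a ζ 1 (Complex.exp (-(Complex.I * θ)) ^ 2))
      (Ioo (-Real.pi) Real.pi)) (P : Polynomial ℂ) :
    2 * Real.pi * ‖P.coeff 0‖ ^ 2 ≤ ∫ θ in Ioo (-Real.pi) Real.pi,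
      ‖P.eval (Complex.exp (-(Complex.I * θ)))‖ ^ 2 *
        prodNormSq Finset.univ a ζ 1 (Complex.exp (-(Complex.I * θ)) ^ 2) := by
  classical
  obtain ⟨C, hC, h⟩ := exists_isDilationPair (a := a) hζ
  obtain ⟨M, hM⟩ := exists_norm_sq_eval_exp_le P
  simp only [IntegrableOn, ← prodNormSq_filter_mul_self] at hI ⊢
  refine h.le_integral hC hI (continuous_norm_sq_eval_exp P).measurable
    (fun _ => by positivity) hM fun r hr r' hr' => ?_
  simp only [prodNormSq_filter_mul]
  set s : ι → ℂ := fun j => ((if 0 < (a j).re then r else r' : ℝ) : ℂ) * ζ j with hs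
  set ρ := max r r' with hρ
  have hρ0 : 0 < ρ := lt_max_of_lt_left hr.1
  have hρ1 : ρ < 1 := max_lt hr.2 hr'.2
  have hsρ : ∀ j, ‖s j‖ ≤ ρ := by
    intro j
    rw [hs]
    simp only [norm_mul, hζ j, mul_one, Complex.norm_real]
    split_ifs
    · rw [Real.norm_of_nonneg hr.1.le]; exact le_max_left _ _
    · rw [Real.norm_of_nonneg hr'.1.le]; exact le_max_right _ _
  obtain ⟨R, hR1, hRρ⟩ : ∃ R : ℝ, 1 < R ∧ ρ * R ^ 2 ≤ 1 := by
    refine ⟨√ρ⁻¹, ?_, ?_⟩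
    · rw [Real.lt_sqrt zero_le_one, one_pow]; exact (one_lt_inv₀ hρ0).2 hρ1
    · rw [Real.sq_sqrt (by positivity), mul_inv_cancel₀ hρ0.ne']
  have hdiff : DifferentiableOn ℂ (fun z => P.eval z * ∏ j, (1 - s j * z ^ 2) ^ a j)
      (Metric.ball 0 R) := by
    refine P.differentiable.differentiableOn.mul ?_
    refine DifferentiableOn.fun_finsetProd fun j _ => ?_
    refine DifferentiableOn.cpow (by fun_prop) (by fun_prop) fun z hz => ?_
    have hz : ‖z‖ < R := by simpa using hz
    have hn : ‖s j * z ^ 2‖ < 1 := by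
      rw [norm_mul, norm_pow]
      calc _ ≤ ρ * ‖z‖ ^ 2 := by gcongr; exact hsρ j
        _ < ρ * R ^ 2 := by gcongr
        _ ≤ 1 := hRρ
    refine one_sub_mem_slitPlane hn.le fun h => ?_
    rw [h, norm_one] at hn
    exact lt_irrefl _ hn
  have := two_pi_mul_norm_sq_le_integral hR1 hdiff
  simpa [Polynomial.coeff_zero_eq_eval_zero, mul_pow] using this

/-- Polynomials normalised at the origin whose weighted norm is almost minimal; their low order
coefficients are close to those of the normalised reciprocal Szegő function. -/
lemma exists_almost_minimal_polynomial (hζ : ∀ j, ‖ζ j‖ = 1)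
    (hI : IntegrableOn (fun θ : ℝ => prodNormSq Finset.univ a ζ 1 (Complex.exp (-(Complex.I * θ)) ^ 2))
      (Ioo (-Real.pi) Real.pi)) {ε : ℝ} (hε : 0 < ε) :
    ∃ Q : Polynomial ℂ, Q.coeff 0 = 1 ∧ ‖Q.coeff 2 - ∑ j, a j * ζ j‖ < ε ∧
      ‖Q.coeff 4 - ((∑ j, a j * ζ j) ^ 2 + ∑ j, a j * ζ j ^ 2) / 2‖ < ε ∧
      ∫ θ in Ioo (-Real.pi) Real.pi, ‖Q.eval (Complex.exp (-(Complex.I * θ)))‖ ^ 2 *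
        prodNormSq Finset.univ a ζ 1 (Complex.exp (-(Complex.I * θ)) ^ 2) < 2 * Real.pi + ε := by
  classical
  obtain ⟨C, hC, h⟩ := exists_isDilationPair (a := a) hζ
  have hI' := hI
  simp only [IntegrableOn, ← prodNormSq_filter_mul_self] at hI'
  have hvol : (volume.restrict (Ioo (-Real.pi) Real.pi)).real univ < 2 * Real.pi + ε / 2 := by
    rw [measureReal_restrict_apply_univ, Real.volume_real_Ioo_of_le (by linarith [Real.pi_pos])]
    linarith
  have hInt := h.eventually_integral_lt hI' hvol
  simp only [prodNormSq_filter_mul_self] at hInt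
  simp only [prodNormSq_filter_mul] at hInt
  set s : ℝ → ℝ → ι → ℂ := fun r r' j => ((if 0 < (a j).re then r else r' : ℝ) : ℂ) * ζ j with hs
  have hev : ∀ᶠ r in 𝓝[<] (1 : ℝ), r ∈ Ioo (0 : ℝ) 1 := Ioo_mem_nhdsLT one_pos
  have hs1 : s 1 1 = ζ := by ext j; simp [hs]
  have nested : ∀ F : (ι → ℂ) → ℂ, Continuous F →
      ∀ᶠ r in 𝓝[<] (1 : ℝ), ∀ᶠ r' in 𝓝[<] (1 : ℝ), ‖F (s r r') - F ζ‖ < ε := by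
    intro F hF
    have hc2 : Continuous fun x : ℝ × ℝ => ‖F (s x.1 x.2) - F ζ‖ := by
      have : Continuous fun x : ℝ × ℝ => s x.1 x.2 := by
        refine continuous_pi fun j => ?_
        simp only [hs]
        split_ifs <;> fun_prop
      fun_prop
    have h1 : ∀ r, Tendsto (fun r' => ‖F (s r r') - F ζ‖) (𝓝[<] 1) (𝓝 ‖F (s r 1) - F ζ‖) :=
      fun r => ((hc2.comp (Continuous.prodMk_right r)).tendsto 1).mono_left nhdsWithin_le_nhds
    have h2 : Tendsto (fun r => ‖F (s r 1) - F ζ‖) (𝓝[<] 1) (𝓝 0) := by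
      have := ((hc2.comp (Continuous.prodMk_left (1 : ℝ))).tendsto 1).mono_left
        (nhdsWithin_le_nhds (s := Iio 1))
      simpa [Function.comp_def, hs1] using this
    filter_upwards [h2.eventually_lt_const hε] with r hr
    exact (h1 r).eventually_lt_const hr
  obtain ⟨r, hr, hInt, hF₁, hF₂⟩ := (hev.and (hInt.and ((nested (fun x => ∑ j, a j * x j)
    (by fun_prop)).and (nested (fun x => ((∑ j, a j * x j) ^ 2 + ∑ j, a j * x j ^ 2) / 2)
    (by fun_prop))))).exists
  obtain ⟨r', hr', hInt, hF₁, hF₂⟩ := (hev.and (hInt.and (hF₁.and hF₂))).exists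
  set ρ := max r r' with hρ
  have hρ1 : ρ < 1 := max_lt hr.2 hr'.2
  have hsρ : ∀ j, ‖s r r' j‖ ≤ ρ := by
    intro j
    rw [hs]
    simp only [norm_mul, hζ j, mul_one, Complex.norm_real]
    split_ifs
    · rw [Real.norm_of_nonneg hr.1.le]; exact le_max_left _ _
    · rw [Real.norm_of_nonneg hr'.1.le]; exact le_max_right _ _
  set H : ℂ → ℂ := fun u => ∏ j, (1 - s r r' j * u) ^ (-a j) with hH
  have hHc : ContinuousOn H (Metric.closedBall 0 1) := by
    refine continuousOn_finsetProd _ fun j _ => ?_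
    refine ContinuousOn.cpow (by fun_prop) continuousOn_const fun z hz => ?_
    have hz : ‖z‖ ≤ 1 := by simpa using hz
    have hn : ‖s r r' j * z‖ < 1 := by
      rw [norm_mul]
      exact (mul_le_of_le_one_right (norm_nonneg _) hz).trans_lt ((hsρ j).trans_lt hρ1)
    refine one_sub_mem_slitPlane hn.le fun h => ?_
    rw [h, norm_one] at hn
    exact lt_irrefl _ hn
  obtain ⟨M, hM⟩ := (isCompact_closedBall (0 : ℂ) 1).bddAbove_image hHc.norm
  have hM' : ∀ u : ℂ, ‖u‖ ≤ 1 → ‖H u‖ ≤ M := fun u hu =>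
    hM (mem_image_of_mem _ (by simpa using hu))
  have hM0 : 0 ≤ M := (norm_nonneg _).trans (hM' 0 (by simp))
  set G : ℝ → ℝ := fun θ => prodNormSq Finset.univ a ζ 1 (Complex.exp (-(Complex.I * θ)) ^ 2) with hG
  have hG0 : ∀ θ, 0 ≤ G θ := fun θ => prodNormSq_nonneg _ _
  set W := ∫ θ in Ioo (-Real.pi) Real.pi, G θ with hW
  have hW0 : 0 ≤ W := integral_nonneg hG0
  obtain ⟨δ, hδ0, hδ1, hδ⟩ : ∃ δ : ℝ, 0 < δ ∧ δ ≤ 1 ∧ (2 * M + 1) * δ * W < ε / 2 := by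
    refine ⟨min 1 (ε / 4 / ((2 * M + 1) * (W + 1))), by positivity, min_le_left _ _, ?_⟩
    have h1 := min_le_right 1 (ε / 4 / ((2 * M + 1) * (W + 1)))
    rw [le_div_iff₀ (by positivity)] at h1
    have h0 : 0 < min 1 (ε / 4 / ((2 * M + 1) * (W + 1))) := by positivity
    nlinarith [mul_pos (show 0 < 2 * M + 1 by positivity) h0]
  obtain ⟨T, hT0, hT1, hT2, hTu⟩ := exists_polynomial_approx_prod_cpow Finset.univ a (s r r') ρ hρ1
    (fun j _ => hsρ j) δ hδ0
  refine ⟨Polynomial.expand ℂ 2 T, ?_, ?_, ?_, ?_⟩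
  · simp [Polynomial.coeff_expand, hT0]
  · simpa [Polynomial.coeff_expand, hT1] using hF₁
  · simpa [Polynomial.coeff_expand, hT2] using hF₂
  · have hv : ∀ θ : ℝ, ‖Complex.exp (-(Complex.I * θ)) ^ 2‖ = 1 := fun θ => by
      rw [norm_pow, norm_exp_neg_I_mul, one_pow]
    have hHm : AEStronglyMeasurable (fun θ : ℝ => ‖H (Complex.exp (-(Complex.I * θ)) ^ 2)‖ ^ 2)
        (volume.restrict (Ioo (-Real.pi) Real.pi)) := by
      apply Measurable.aestronglyMeasurable
      simp only [hH]
      fun_prop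
    have hHI : IntegrableOn (fun θ : ℝ => ‖H (Complex.exp (-(Complex.I * θ)) ^ 2)‖ ^ 2 * G θ)
        (Ioo (-Real.pi) Real.pi) := by
      refine Integrable.bdd_mul (c := M ^ 2) hI hHm (.of_forall fun θ => ?_)
      rw [Real.norm_of_nonneg (by positivity)]
      gcongr
      exact hM' _ (hv θ).le
    have hHeq : ∫ θ in Ioo (-Real.pi) Real.pi, ‖H (Complex.exp (-(Complex.I * θ)) ^ 2)‖ ^ 2 * G θ
        < 2 * Real.pi + ε / 2 := by
      refine lt_of_eq_of_lt ?_ hInt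
      congr 1
      ext θ
      simp [hH, hs, hG, Complex.cpow_neg, Finset.prod_inv_distrib]
    calc _ ≤ ∫ θ in Ioo (-Real.pi) Real.pi,
          (‖H (Complex.exp (-(Complex.I * θ)) ^ 2)‖ ^ 2 * G θ + (2 * M + 1) * δ * G θ) := by
            refine integral_mono_of_nonneg (.of_forall fun θ => ?_)
              (hHI.add (hI.const_mul _)) (.of_forall fun θ => ?_)
            · exact mul_nonneg (by positivity) (hG0 θ)
            · simp only [Polynomial.expand_eval, ← add_mul]
              refine mul_le_mul_of_nonneg_right ?_ (hG0 θ)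
              set u := Complex.exp (-(Complex.I * (θ : ℂ))) ^ 2
              have h1 := hTu u (hv θ).le
              have h2 := hM' u (hv θ).le
              have h3 : ‖T.eval u‖ ≤ ‖H u‖ + δ := by
                have := norm_sub_norm_le (T.eval u) (H u)
                linarith
              have h4 : ‖T.eval u‖ ^ 2 ≤ (‖H u‖ + δ) ^ 2 := by gcongr
              nlinarith [norm_nonneg (H u)]
      _ = (∫ θ in Ioo (-Real.pi) Real.pi, ‖H (Complex.exp (-(Complex.I * θ)) ^ 2)‖ ^ 2 * G θ)
          + (2 * M + 1) * δ * W := by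
            rw [integral_add hHI (hI.const_mul _), integral_const_mul]
      _ < _ := by linarith

end weight

section extremal

variable {w : ℝ → ℝ}

lemma integrableOn_norm_sq_eval_mul (hI : IntegrableOn w (Ioo (-Real.pi) Real.pi))
    (P : Polynomial ℂ) :
    IntegrableOn (fun θ : ℝ => ‖P.eval (Complex.exp (-(Complex.I * θ)))‖ ^ 2 * w θ)
      (Ioo (-Real.pi) Real.pi) := by
  obtain ⟨M, hM⟩ := exists_norm_sq_eval_exp_le P
  refine Integrable.bdd_mul (c := M) hI
    (continuous_norm_sq_eval_exp P).aestronglyMeasurable (.of_forall fun θ => ?_)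
  rw [Real.norm_of_nonneg (by positivity)]
  exact hM θ

lemma integrableOn_eval_mul_conj_eval_mul (hI : IntegrableOn w (Ioo (-Real.pi) Real.pi))
    {e : ℝ → ℂ} (he : Continuous e) (P Q : Polynomial ℂ) :
    IntegrableOn (fun θ : ℝ => P.eval (e θ) * (starRingEnd ℂ) (Q.eval (e θ)) * (w θ : ℂ))
      (Ioo (-Real.pi) Real.pi) := by
  have hP := P.continuous
  have hQ := Q.continuous
  have hc : Continuous fun θ : ℝ => P.eval (e θ) * (starRingEnd ℂ) (Q.eval (e θ)) := by
    have := Complex.continuous_conj.comp (hQ.comp he)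
    exact (hP.comp he).mul this
  obtain ⟨M, hM⟩ := (isCompact_Icc (a := -Real.pi) (b := Real.pi)).bddAbove_image
    hc.norm.continuousOn
  refine Integrable.bdd_mul (c := M) hI.ofReal hc.aestronglyMeasurable ?_
  filter_upwards [ae_restrict_mem measurableSet_Ioo] with θ hθ
  exact hM (mem_image_of_mem _ (Ioo_subset_Icc_self hθ))

/-- If the weighted norm controls the constant coefficient, it controls every coefficient. -/
lemma exists_norm_sq_coeff_le (hw : ∀ᵐ θ ∂(volume.restrict (Ioo (-Real.pi) Real.pi)), 0 ≤ w θ)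
    (hI : IntegrableOn w (Ioo (-Real.pi) Real.pi)) {m : ℝ} (hm : 0 < m)
    (hlow : ∀ P : Polynomial ℂ, m * ‖P.coeff 0‖ ^ 2 ≤
      ∫ θ in Ioo (-Real.pi) Real.pi, ‖P.eval (Complex.exp (-(Complex.I * θ)))‖ ^ 2 * w θ) (j : ℕ) :
    ∃ C : ℝ, 0 ≤ C ∧ ∀ P : Polynomial ℂ, ‖P.coeff j‖ ^ 2 ≤
      C * ∫ θ in Ioo (-Real.pi) Real.pi, ‖P.eval (Complex.exp (-(Complex.I * θ)))‖ ^ 2 * w θ := by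
  induction j with
  | zero =>
    refine ⟨m⁻¹, by positivity, fun P => ?_⟩
    rw [← div_eq_inv_mul, le_div_iff₀ hm, mul_comm]
    exact hlow P
  | succ j ih =>
    obtain ⟨C, hC, h⟩ := ih
    set W := ∫ θ in Ioo (-Real.pi) Real.pi, w θ with hW
    have hW0 : 0 ≤ W := integral_nonneg_of_ae hw
    refine ⟨C * (2 + 2 * (m⁻¹ * W)), by positivity, fun P => ?_⟩
    rw [← Polynomial.coeff_divX]
    refine (h P.divX).trans ?_
    rw [mul_assoc]
    refine mul_le_mul_of_nonneg_left ?_ hC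
    set N := ∫ θ in Ioo (-Real.pi) Real.pi, ‖P.eval (Complex.exp (-(Complex.I * θ)))‖ ^ 2 * w θ
      with hN
    have hle : ‖P.coeff 0‖ ^ 2 ≤ m⁻¹ * N := by
      rw [← div_eq_inv_mul, le_div_iff₀ hm, mul_comm]
      exact hlow P
    calc _ ≤ ∫ θ in Ioo (-Real.pi) Real.pi,
          (2 * (‖P.eval (Complex.exp (-(Complex.I * θ)))‖ ^ 2 * w θ)
            + 2 * ‖P.coeff 0‖ ^ 2 * w θ) := by
            refine integral_mono_ae (integrableOn_norm_sq_eval_mul hI _)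
              (((integrableOn_norm_sq_eval_mul hI P).const_mul 2).add (hI.const_mul _)) ?_
            filter_upwards [hw] with θ hθ
            simp only [← mul_assoc, ← add_mul]
            refine mul_le_mul_of_nonneg_right ?_ hθ
            set z := Complex.exp (-(Complex.I * (θ : ℂ))) with hz
            have h1 : P.eval z - P.coeff 0 = P.divX.eval z * z := by
              conv_lhs => rw [← Polynomial.divX_mul_X_add P]
              simp
            have h2 : ‖P.divX.eval z‖ = ‖P.eval z - P.coeff 0‖ := by
              rw [h1, norm_mul, hz, norm_exp_neg_I_mul, mul_one]
            have h3 := norm_sub_le (P.eval z) (P.coeff 0)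
            rw [h2]
            calc _ ≤ (‖P.eval z‖ + ‖P.coeff 0‖) ^ 2 := by gcongr
              _ ≤ _ := by nlinarith [sq_nonneg (‖P.eval z‖ - ‖P.coeff 0‖)]
      _ = 2 * N + 2 * ‖P.coeff 0‖ ^ 2 * W := by
            rw [integral_add ((integrableOn_norm_sq_eval_mul hI P).const_mul 2) (hI.const_mul _),
              integral_const_mul, integral_const_mul]
      _ ≤ 2 * N + 2 * (m⁻¹ * N) * W := by gcongr
      _ = _ := by ring

variable {φ : ℕ → Polynomial ℂ}

lemma integral_mul_conj_eq_zero_of_degree_lt (hI : IntegrableOn w (Ioo (-Real.pi) Real.pi))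
    {e : ℝ → ℂ} (he : Continuous e)
    (hdeg : ∀ n, (φ n).natDegree = n) (hlead : ∀ n, (φ n).coeff n ≠ 0)
    (horth : ∀ m n, m ≠ n → (∫ θ in Ioo (-Real.pi) Real.pi,
      (φ m).eval (e θ) * (starRingEnd ℂ) ((φ n).eval (e θ)) * (w θ : ℂ)) = 0)
    (n : ℕ) (P : Polynomial ℂ) (hP : P.degree < n) :
    ∫ θ in Ioo (-Real.pi) Real.pi,
      (φ n).eval (e θ) * (starRingEnd ℂ) (P.eval (e θ)) * (w θ : ℂ) = 0 := by
  suffices h : ∀ k ≤ n, ∀ P : Polynomial ℂ, P.degree < k → ∫ θ in Ioo (-Real.pi) Real.pi,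
      (φ n).eval (e θ) * (starRingEnd ℂ) (P.eval (e θ)) * (w θ : ℂ) = 0 from h n le_rfl P hP
  intro k
  induction k with
  | zero =>
    intro _ P hP
    have : P = 0 := by
      rw [← Polynomial.degree_eq_bot]
      exact Nat.WithBot.lt_zero_iff.1 (by simpa using hP)
    simp [this]
  | succ k ih =>
    intro hk P hP
    set c := P.coeff k / (φ k).coeff k with hc
    have hlt : (P - Polynomial.C c * φ k).degree < k := by
      rw [Polynomial.degree_lt_iff_coeff_zero]
      intro i hi
      rw [Polynomial.coeff_sub, Polynomial.coeff_C_mul]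
      rcases hi.eq_or_lt with rfl | hi
      · rw [hc, div_mul_cancel₀ _ (hlead _), sub_self]
      · rw [Polynomial.degree_lt_iff_coeff_zero] at hP
        rw [hP i hi, Polynomial.coeff_eq_zero_of_natDegree_lt (by rw [hdeg]; exact hi), mul_zero,
          sub_zero]
    have h1 := ih (by omega) _ hlt
    have h2 := horth n k (by omega)
    have hsplit : (fun θ : ℝ => (φ n).eval (e θ) * (starRingEnd ℂ) (P.eval (e θ)) * (w θ : ℂ)) =
        fun θ : ℝ => (φ n).eval (e θ) *
            (starRingEnd ℂ) ((P - Polynomial.C c * φ k).eval (e θ)) * (w θ : ℂ)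
          + (starRingEnd ℂ) c *
            ((φ n).eval (e θ) * (starRingEnd ℂ) ((φ k).eval (e θ)) * (w θ : ℂ)) := by
      ext θ
      simp only [Polynomial.eval_sub, Polynomial.eval_mul, Polynomial.eval_C, map_sub, map_mul]
      ring
    rw [hsplit, integral_add (integrableOn_eval_mul_conj_eval_mul hI he _ _)
      ((integrableOn_eval_mul_conj_eval_mul hI he _ _).const_mul _), integral_const_mul, h1, h2]
    simp

lemma eval_reflect_mul_pow (n : ℕ) (P : Polynomial ℂ) (hP : P.natDegree ≤ n) (θ : ℝ) :
    (P.reflect n).eval (Complex.exp (-(Complex.I * θ))) * Complex.exp (Complex.I * θ) ^ n =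
      P.eval (Complex.exp (Complex.I * θ)) := by
  let _ := invertibleOfNonzero (Complex.exp_ne_zero (Complex.I * θ))
  have := Polynomial.eval₂_reflect_mul_pow (RingHom.id ℂ) (Complex.exp (Complex.I * θ)) n P hP
  rwa [invOf_eq_inv, ← Complex.exp_neg] at this

/-- Pythagoras for the reversed monic orthogonal polynomial, which is the projection. -/
lemma integral_norm_sq_eq_add (hI : IntegrableOn w (Ioo (-Real.pi) Real.pi))
    (hdeg : ∀ n, (φ n).natDegree = n) (hlead : ∀ n, (φ n).coeff n ≠ 0)
    (horth : ∀ m n, m ≠ n → (∫ θ in Ioo (-Real.pi) Real.pi,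
      (φ m).eval (Complex.exp (Complex.I * θ)) *
        (starRingEnd ℂ) ((φ n).eval (Complex.exp (Complex.I * θ))) * (w θ : ℂ)) = 0)
    {n : ℕ} {Q R : Polynomial ℂ} (hR : R = Polynomial.C ((φ n).coeff n)⁻¹ * (φ n).reflect n)
    (hQ0 : Q.coeff 0 = 1) (hQn : Q.natDegree ≤ n) :
    ∫ θ in Ioo (-Real.pi) Real.pi, ‖Q.eval (Complex.exp (-(Complex.I * θ)))‖ ^ 2 * w θ =
      (∫ θ in Ioo (-Real.pi) Real.pi, ‖R.eval (Complex.exp (-(Complex.I * θ)))‖ ^ 2 * w θ) +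
      ∫ θ in Ioo (-Real.pi) Real.pi, ‖(Q - R).eval (Complex.exp (-(Complex.I * θ)))‖ ^ 2 * w θ := by
  have he : Continuous fun θ : ℝ => Complex.exp (Complex.I * θ) := by fun_prop
  have he' : Continuous fun θ : ℝ => Complex.exp (-(Complex.I * θ)) := by fun_prop
  have hR0 : R.coeff 0 = 1 := by
    rw [hR, Polynomial.coeff_C_mul, Polynomial.coeff_reflect, Polynomial.revAt_le (Nat.zero_le n),
      Nat.sub_zero, inv_mul_cancel₀ (hlead n)]
  have hRn : R.natDegree ≤ n := by
    rw [hR]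
    refine (Polynomial.natDegree_C_mul_le _ _).trans (Polynomial.natDegree_reflect_le.trans ?_)
    rw [hdeg, max_self]
  set S := Q - R with hS
  have hSn : S.natDegree ≤ n := (Polynomial.natDegree_sub_le _ _).trans (max_le hQn hRn)
  have hS0 : S.coeff 0 = 0 := by rw [hS, Polynomial.coeff_sub, hQ0, hR0, sub_self]
  have hS'n : (S.reflect n).natDegree ≤ n :=
    Polynomial.natDegree_reflect_le.trans (max_le le_rfl hSn)
  have hS'deg : (S.reflect n).degree < n := by
    rw [Polynomial.degree_lt_iff_coeff_zero]
    intro i hi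
    rcases hi.eq_or_lt with rfl | hi
    · rw [Polynomial.coeff_reflect, Polynomial.revAt_le le_rfl, Nat.sub_self, hS0]
    · exact Polynomial.coeff_eq_zero_of_natDegree_lt (hS'n.trans_lt hi)
  have hzero : ∫ θ in Ioo (-Real.pi) Real.pi, R.eval (Complex.exp (-(Complex.I * θ))) *
      (starRingEnd ℂ) (S.eval (Complex.exp (-(Complex.I * θ)))) * (w θ : ℂ) = 0 := by
    have h := integral_mul_conj_eq_zero_of_degree_lt hI he hdeg hlead horth n _ hS'deg
    have hpt : ∀ θ : ℝ, R.eval (Complex.exp (-(Complex.I * θ))) *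
        (starRingEnd ℂ) (S.eval (Complex.exp (-(Complex.I * θ)))) * (w θ : ℂ) =
        ((φ n).coeff n)⁻¹ * ((φ n).eval (Complex.exp (Complex.I * θ)) *
          (starRingEnd ℂ) ((S.reflect n).eval (Complex.exp (Complex.I * θ))) * (w θ : ℂ)) := by
      intro θ
      have h1 := eval_reflect_mul_pow n (φ n) (hdeg n).le θ
      have h2 := eval_reflect_mul_pow n (S.reflect n) hS'n θ
      rw [Polynomial.reflect_reflect] at h2
      have h3 : Complex.exp (Complex.I * θ) ^ n *
          (starRingEnd ℂ) (Complex.exp (Complex.I * θ) ^ n) = 1 := by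
        rw [Complex.mul_conj, Complex.normSq_eq_norm_sq, norm_pow, mul_comm Complex.I,
          Complex.norm_exp_ofReal_mul_I]
        simp
      rw [← h1, ← h2, hR, Polynomial.eval_mul, Polynomial.eval_C, map_mul]
      linear_combination (-((φ n).coeff n)⁻¹ *
        ((φ n).reflect n).eval (Complex.exp (-(Complex.I * θ))) *
        (starRingEnd ℂ) (S.eval (Complex.exp (-(Complex.I * θ)))) * (w θ : ℂ)) * h3
    simp only [hpt]
    rw [integral_const_mul, h, mul_zero]
  have hInt := integrableOn_eval_mul_conj_eval_mul hI he' R S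
  have hre : ∫ θ in Ioo (-Real.pi) Real.pi, (R.eval (Complex.exp (-(Complex.I * θ))) *
      (starRingEnd ℂ) (S.eval (Complex.exp (-(Complex.I * θ)))) * (w θ : ℂ)).re = 0 := by
    have := Complex.reCLM.integral_comp_comm hInt
    simpa [hzero] using this
  have hexp : ∀ θ : ℝ, ‖Q.eval (Complex.exp (-(Complex.I * θ)))‖ ^ 2 * w θ =
      ‖R.eval (Complex.exp (-(Complex.I * θ)))‖ ^ 2 * w θ +
      ‖S.eval (Complex.exp (-(Complex.I * θ)))‖ ^ 2 * w θ +
      2 * (R.eval (Complex.exp (-(Complex.I * θ))) *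
      (starRingEnd ℂ) (S.eval (Complex.exp (-(Complex.I * θ)))) * (w θ : ℂ)).re := by
    intro θ
    have hQ : Q = R + S := by rw [hS]; ring
    rw [hQ, Polynomial.eval_add, ← Complex.normSq_eq_norm_sq, ← Complex.normSq_eq_norm_sq,
      ← Complex.normSq_eq_norm_sq, Complex.normSq_add, Complex.re_mul_ofReal]
    ring
  simp only [hexp]
  have hNR := integrableOn_norm_sq_eval_mul hI R
  have hNS := integrableOn_norm_sq_eval_mul hI S
  have hNRS : IntegrableOn (fun θ : ℝ => ‖R.eval (Complex.exp (-(Complex.I * θ)))‖ ^ 2 * w θ +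
      ‖S.eval (Complex.exp (-(Complex.I * θ)))‖ ^ 2 * w θ) (Ioo (-Real.pi) Real.pi) := hNR.add hNS
  have hcross : IntegrableOn (fun θ : ℝ => 2 * (R.eval (Complex.exp (-(Complex.I * θ))) *
      (starRingEnd ℂ) (S.eval (Complex.exp (-(Complex.I * θ)))) * (w θ : ℂ)).re)
      (Ioo (-Real.pi) Real.pi) := Integrable.const_mul hInt.re 2
  rw [integral_add hNRS hcross, integral_add hNR hNS, integral_const_mul, hre, mul_zero, add_zero]

/-- Convergence of the leading coefficients of orthogonal polynomials on the unit circle, from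
almost minimal polynomials for the extremal problem at the origin. -/
lemma tendsto_coeff_div_leadingCoeff
    (hw : ∀ᵐ θ ∂(volume.restrict (Ioo (-Real.pi) Real.pi)), 0 ≤ w θ)
    (hI : IntegrableOn w (Ioo (-Real.pi) Real.pi))
    (hdeg : ∀ n, (φ n).natDegree = n) (hlead : ∀ n, (φ n).coeff n ≠ 0)
    (horth : ∀ m n, m ≠ n → (∫ θ in Ioo (-Real.pi) Real.pi,
      (φ m).eval (Complex.exp (Complex.I * θ)) *
        (starRingEnd ℂ) ((φ n).eval (Complex.exp (Complex.I * θ))) * (w θ : ℂ)) = 0)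
    {m : ℝ} (hm : 0 < m)
    (hlow : ∀ P : Polynomial ℂ, m * ‖P.coeff 0‖ ^ 2 ≤
      ∫ θ in Ioo (-Real.pi) Real.pi, ‖P.eval (Complex.exp (-(Complex.I * θ)))‖ ^ 2 * w θ)
    {j : ℕ} {L : ℂ}
    (hupp : ∀ ε > 0, ∃ Q : Polynomial ℂ, Q.coeff 0 = 1 ∧ ‖Q.coeff j - L‖ < ε ∧
      ∫ θ in Ioo (-Real.pi) Real.pi, ‖Q.eval (Complex.exp (-(Complex.I * θ)))‖ ^ 2 * w θ < m + ε) :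
    Tendsto (fun n => (φ n).coeff (n - j) / (φ n).coeff n) atTop (𝓝 L) := by
  obtain ⟨C, hC, hCle⟩ := exists_norm_sq_coeff_le hw hI hm hlow j
  rw [Metric.tendsto_atTop]
  intro ε hε
  obtain ⟨δ, hδ0, hδε, hδC⟩ : ∃ δ : ℝ, 0 < δ ∧ δ ≤ ε / 2 ∧ C * δ < (ε / 2) ^ 2 := by
    refine ⟨min (ε / 2) ((ε / 2) ^ 2 / (C + 1)), by positivity, min_le_left _ _, ?_⟩
    have h1 := min_le_right (ε / 2) ((ε / 2) ^ 2 / (C + 1))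
    rw [le_div_iff₀ (by positivity)] at h1
    have h0 : 0 < min (ε / 2) ((ε / 2) ^ 2 / (C + 1)) := by positivity
    linarith
  obtain ⟨Q, hQ0, hQj, hQN⟩ := hupp δ hδ0
  refine ⟨max Q.natDegree j, fun n hn => ?_⟩
  set R := Polynomial.C ((φ n).coeff n)⁻¹ * (φ n).reflect n with hR
  have hRj : ∀ i ≤ n, R.coeff i = (φ n).coeff (n - i) / (φ n).coeff n := by
    intro i hi
    rw [hR, Polynomial.coeff_C_mul, Polynomial.coeff_reflect, Polynomial.revAt_le hi,
      div_eq_inv_mul]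
  have hpyth := integral_norm_sq_eq_add hI hdeg hlead horth hR hQ0 ((le_max_left _ _).trans hn)
  have hRlow := hlow R
  rw [hRj 0 (Nat.zero_le n), Nat.sub_zero, div_self (hlead n), norm_one, one_pow, mul_one] at hRlow
  have hcoef := hCle (Q - R)
  have hlt : ‖(Q - R).coeff j‖ < ε / 2 := by
    refine lt_of_pow_lt_pow_left₀ 2 (by positivity) ?_
    refine (hcoef.trans ?_).trans_lt hδC
    refine mul_le_mul_of_nonneg_left ?_ hC
    linarith
  rw [← hRj j ((le_max_right _ _).trans hn), dist_eq_norm]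
  rw [Polynomial.coeff_sub, norm_sub_rev] at hlt
  calc _ = ‖(R.coeff j - Q.coeff j) + (Q.coeff j - L)‖ := by congr 1; ring
    _ ≤ _ := norm_add_le _ _
    _ < ε := by linarith

end extremal

/-- Szegő asymptotics of the leading coefficients for a weight that is the squared modulus of
a product of powers with zeros on the unit circle. -/
lemma tendsto_coeff_of_prodNormSq {ι : Type*} [Fintype ι] {a ζ : ι → ℂ} (hζ : ∀ j, ‖ζ j‖ = 1)
    {w : ℝ → ℝ} {c : ℝ} (hc : 0 < c)
    (hw : ∀ᵐ θ : ℝ ∂(volume.restrict (Ioo (-Real.pi) Real.pi)),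
      w θ = c * prodNormSq Finset.univ a ζ 1 (Complex.exp (-(Complex.I * θ)) ^ 2))
    (hI : IntegrableOn w (Ioo (-Real.pi) Real.pi)) {φ : ℕ → Polynomial ℂ}
    (hdeg : ∀ n, (φ n).natDegree = n) (hlead : ∀ n, (φ n).coeff n ≠ 0)
    (horth : ∀ m n, m ≠ n → (∫ θ in Ioo (-Real.pi) Real.pi,
      (φ m).eval (Complex.exp (Complex.I * θ)) *
        (starRingEnd ℂ) ((φ n).eval (Complex.exp (Complex.I * θ))) * (w θ : ℂ)) = 0) :
    Tendsto (fun n => (φ n).coeff (n - 2) / (φ n).coeff n) atTop (𝓝 (∑ j, a j * ζ j)) ∧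
    Tendsto (fun n => (φ n).coeff (n - 4) / (φ n).coeff n) atTop
      (𝓝 (((∑ j, a j * ζ j) ^ 2 + ∑ j, a j * ζ j ^ 2) / 2)) := by
  have hw0 : ∀ᵐ θ ∂(volume.restrict (Ioo (-Real.pi) Real.pi)), 0 ≤ w θ := by
    filter_upwards [hw] with θ hθ
    rw [hθ]
    exact mul_nonneg hc.le (prodNormSq_nonneg _ _)
  have hIG : IntegrableOn (fun θ : ℝ =>
      prodNormSq Finset.univ a ζ 1 (Complex.exp (-(Complex.I * θ)) ^ 2))
      (Ioo (-Real.pi) Real.pi) := by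
    refine (Integrable.const_mul hI c⁻¹).congr ?_
    filter_upwards [hw] with θ hθ
    rw [hθ, inv_mul_cancel_left₀ hc.ne']
  have hN : ∀ P : Polynomial ℂ,
      ∫ θ in Ioo (-Real.pi) Real.pi, ‖P.eval (Complex.exp (-(Complex.I * θ)))‖ ^ 2 * w θ =
      c * ∫ θ in Ioo (-Real.pi) Real.pi, ‖P.eval (Complex.exp (-(Complex.I * θ)))‖ ^ 2 *
        prodNormSq Finset.univ a ζ 1 (Complex.exp (-(Complex.I * θ)) ^ 2) := by
    intro P
    rw [← integral_const_mul]
    refine integral_congr_ae ?_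
    filter_upwards [hw] with θ hθ
    rw [hθ]
    ring
  have hm : 0 < c * (2 * Real.pi) := by positivity
  have hlow : ∀ P : Polynomial ℂ, c * (2 * Real.pi) * ‖P.coeff 0‖ ^ 2 ≤
      ∫ θ in Ioo (-Real.pi) Real.pi, ‖P.eval (Complex.exp (-(Complex.I * θ)))‖ ^ 2 * w θ := by
    intro P
    rw [hN, mul_assoc]
    exact mul_le_mul_of_nonneg_left (two_pi_mul_norm_sq_coeff_zero_le hζ hIG P) hc.le
  have hupp : ∀ ε > 0, ∃ Q : Polynomial ℂ, Q.coeff 0 = 1 ∧ ‖Q.coeff 2 - ∑ j, a j * ζ j‖ < ε ∧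
      ‖Q.coeff 4 - ((∑ j, a j * ζ j) ^ 2 + ∑ j, a j * ζ j ^ 2) / 2‖ < ε ∧
      ∫ θ in Ioo (-Real.pi) Real.pi, ‖Q.eval (Complex.exp (-(Complex.I * θ)))‖ ^ 2 * w θ
        < c * (2 * Real.pi) + ε := by
    intro ε hε
    obtain ⟨Q, h0, h2, h4, hQ⟩ := exists_almost_minimal_polynomial hζ hIG
      (ε := min ε (ε / c)) (by positivity)
    refine ⟨Q, h0, h2.trans_le (min_le_left _ _), h4.trans_le (min_le_left _ _), ?_⟩
    rw [hN]
    have h5 := hQ.trans_le (add_le_add_right (min_le_right ε (ε / c)) (2 * Real.pi))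
    calc _ < c * (2 * Real.pi + ε / c) := by gcongr
      _ = _ := by field_simp
  constructor
  · refine tendsto_coeff_div_leadingCoeff hw0 hI hdeg hlead horth hm hlow fun ε hε => ?_
    obtain ⟨Q, h0, h2, -, hQ⟩ := hupp ε hε
    exact ⟨Q, h0, h2, hQ⟩
  · refine tendsto_coeff_div_leadingCoeff hw0 hI hdeg hlead horth hm hlow fun ε hε => ?_
    obtain ⟨Q, h0, -, h4, hQ⟩ := hupp ε hε
    exact ⟨Q, h0, h4, hQ⟩

lemma norm_cpow_sq {x : ℂ} (hx : x ≠ 0) (a : ℂ) :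
    ‖x ^ a‖ ^ 2 = ‖x‖ ^ (2 * a.re) * Real.exp (-(2 * (x.arg * a.im))) := by
  rw [Complex.norm_cpow_of_ne_zero hx, div_pow, mul_comm 2 a.re, Real.rpow_mul (norm_nonneg _),
    Real.rpow_two, Real.exp_neg, div_eq_mul_inv, ← Real.exp_nat_mul]
  norm_num

lemma arg_sub_arg_of_mul_conj_eq {x y : ℂ} (hx : 0 < x.re) (hy : 0 < y.re) {r t : ℝ} (hr : 0 < r)
    (ht : t ∈ Ioc (-Real.pi) Real.pi)
    (h : x * (starRingEnd ℂ) y = r * Complex.exp (t * Complex.I)) : x.arg - y.arg = t := by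
  have hx' := abs_lt.1 (Complex.abs_arg_lt_pi_div_two_iff.2 (Or.inl hx))
  have hy' := abs_lt.1 (Complex.abs_arg_lt_pi_div_two_iff.2 (Or.inl hy))
  have hx0 : x ≠ 0 := fun h => by simp [h] at hx
  have hy0 : y ≠ 0 := fun h => by simp [h] at hy
  have hconj : ((starRingEnd ℂ) y).arg = -y.arg := by
    rw [Complex.arg_conj, if_neg (by linarith [Real.pi_pos])]
  have hmul := (Complex.arg_mul_eq_add_arg_iff hx0
    ((map_ne_zero (starRingEnd ℂ)).2 hy0)).2 (by rw [hconj]; constructor <;> linarith)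
  rw [h, Complex.arg_real_mul _ hr, Complex.exp_mul_I, Complex.arg_cos_add_sin_mul_I ht,
    hconj] at hmul
  linarith

/-- The exponents of the Szegő function of the circle weight. -/
noncomputable def szegoExponent (α β γ lam : ℝ) : Fin 4 → ℂ :=
  ![(α + 1 / 2 : ℝ), (β + 1 / 2 : ℝ), (γ / 2 : ℝ) - lam * Complex.I, (γ / 2 : ℝ) + lam * Complex.I]

/-- The (squared) singularities of the Szegő function of the circle weight. -/
noncomputable def szegoNode (θ₀ : ℝ) : Fin 4 → ℂ :=
  fun j => Complex.exp (Complex.I * ((![0, Real.pi, θ₀, -θ₀] : Fin 4 → ℝ) j : ℝ))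

lemma norm_szegoNode (θ₀ : ℝ) (j : Fin 4) : ‖szegoNode θ₀ j‖ = 1 := by
  rw [szegoNode, mul_comm, Complex.norm_exp_ofReal_mul_I]

lemma sum_exponent_mul_node (α β γ lam θ₀ : ℝ) :
    ∑ j, szegoExponent α β γ lam j * szegoNode θ₀ j =
      ((α - β + γ * Real.cos θ₀ + 2 * lam * Real.sin θ₀ : ℝ) : ℂ) := by
  have h1 : Complex.exp (Complex.I * θ₀) = Complex.cos θ₀ + Complex.sin θ₀ * Complex.I := by
    rw [mul_comm, Complex.exp_mul_I]
  have h2 : Complex.exp (-(Complex.I * θ₀)) = Complex.cos θ₀ - Complex.sin θ₀ * Complex.I := by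
    rw [show -(Complex.I * (θ₀ : ℂ)) = (-θ₀ : ℂ) * Complex.I by ring, Complex.exp_mul_I]
    simp [sub_eq_add_neg]
  have h3 : Complex.exp (Complex.I * Real.pi) = -1 := by rw [mul_comm, Complex.exp_pi_mul_I]
  simp [Fin.sum_univ_four, szegoExponent, szegoNode, h1, h2, h3]
  linear_combination (-2 * lam * Complex.sin θ₀) * Complex.I_sq

lemma sum_exponent_mul_node_sq (α β γ lam θ₀ : ℝ) :
    ∑ j, szegoExponent α β γ lam j * szegoNode θ₀ j ^ 2 =
      ((α + β + 1 + γ * Real.cos (2 * θ₀) + 2 * lam * Real.sin (2 * θ₀) : ℝ) : ℂ) := by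
  have h1 : Complex.exp (Complex.I * θ₀) ^ 2 =
      Complex.cos (2 * θ₀) + Complex.sin (2 * θ₀) * Complex.I := by
    rw [← Complex.exp_mul_I, ← Complex.exp_nat_mul]
    congr 1
    push_cast
    ring
  have h2 : Complex.exp (-(Complex.I * θ₀)) ^ 2 =
      Complex.cos (2 * θ₀) - Complex.sin (2 * θ₀) * Complex.I := by
    rw [← Complex.exp_nat_mul, show ((2 : ℕ) : ℂ) * -(Complex.I * (θ₀ : ℂ)) =
      (-(2 * θ₀) : ℂ) * Complex.I by push_cast; ring, Complex.exp_mul_I]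
    simp [sub_eq_add_neg]
  have h3 : Complex.exp (Complex.I * Real.pi) = -1 := by rw [mul_comm, Complex.exp_pi_mul_I]
  simp [Fin.sum_univ_four, szegoExponent, szegoNode, h1, h2, h3]
  linear_combination (-2 * lam * Complex.sin (2 * θ₀)) * Complex.I_sq

lemma szegoNode_mul (θ₀ θ : ℝ) (j : Fin 4) :
    szegoNode θ₀ j * Complex.exp (-(Complex.I * θ)) ^ 2 =
      Complex.exp (Complex.I * ((![0, Real.pi, θ₀, -θ₀] : Fin 4 → ℝ) j - 2 * θ : ℝ)) := by
  rw [szegoNode, ← Complex.exp_nat_mul, ← Complex.exp_add]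
  congr 1
  push_cast
  ring

lemma norm_one_sub_szegoNode_mul (θ₀ θ : ℝ) (j : Fin 4) :
    ‖1 - szegoNode θ₀ j * Complex.exp (-(Complex.I * θ)) ^ 2‖ =
      2 * |Real.sin ((![0, Real.pi, θ₀, -θ₀] : Fin 4 → ℝ) j / 2 - θ)| := by
  rw [szegoNode_mul, norm_sub_rev, Complex.norm_exp_I_mul_ofReal_sub_one, norm_mul,
    Real.norm_eq_abs, Real.norm_eq_abs, abs_two]
  congr 3
  ring

lemma one_sub_szegoNode_mul_conj (θ₀ θ : ℝ) :
    (1 - szegoNode θ₀ 2 * Complex.exp (-(Complex.I * θ)) ^ 2) *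
      (starRingEnd ℂ) (1 - szegoNode θ₀ 3 * Complex.exp (-(Complex.I * θ)) ^ 2) =
    (2 * (Real.cos θ₀ - Real.cos (2 * θ)) : ℝ) * Complex.exp (θ₀ * Complex.I) := by
  have e1 : Complex.exp (Complex.I * ((θ₀ - 2 * θ : ℝ) : ℂ)) =
      Complex.exp (θ₀ * Complex.I) * Complex.exp (-(2 * θ) * Complex.I) := by
    rw [← Complex.exp_add]; congr 1; push_cast; ring
  have e2 : (starRingEnd ℂ) (Complex.exp (Complex.I * ((-θ₀ - 2 * θ : ℝ) : ℂ))) =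
      Complex.exp (θ₀ * Complex.I) * Complex.exp ((2 * θ) * Complex.I) := by
    rw [← Complex.exp_conj, ← Complex.exp_add]; congr 1
    rw [map_mul, Complex.conj_I, Complex.conj_ofReal]; push_cast; ring
  have e3 : Complex.exp (-(2 * θ) * Complex.I) * Complex.exp ((2 * θ) * Complex.I) = 1 := by
    rw [← Complex.exp_add]; simp
  have e4 : Complex.exp (θ₀ * Complex.I) * Complex.exp (-θ₀ * Complex.I) = 1 := by
    rw [← Complex.exp_add]; simp
  rw [szegoNode_mul, szegoNode_mul, map_sub, map_one]
  simp only [Matrix.cons_val]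
  rw [e1, e2]
  push_cast
  rw [Complex.cos, Complex.cos]
  linear_combination Complex.exp (θ₀ * Complex.I) ^ 2 * e3 - e4

lemma prodNormSq_szego (α β γ lam : ℝ) {θ₀ θ : ℝ}
    (hne : ∀ j, szegoNode θ₀ j * Complex.exp (-(Complex.I * θ)) ^ 2 ≠ 1) :
    prodNormSq Finset.univ (szegoExponent α β γ lam) (szegoNode θ₀) 1
        (Complex.exp (-(Complex.I * θ)) ^ 2) =
      (2 * |Real.sin θ|) ^ (2 * α + 1) * (2 * |Real.cos θ|) ^ (2 * β + 1) *
        (4 * |Real.cos θ ^ 2 - Real.cos (θ₀ / 2) ^ 2|) ^ γ *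
        Real.exp (2 * lam * ((1 - szegoNode θ₀ 2 * Complex.exp (-(Complex.I * θ)) ^ 2).arg -
          (1 - szegoNode θ₀ 3 * Complex.exp (-(Complex.I * θ)) ^ 2).arg)) := by
  have hne' : ∀ j, 1 - szegoNode θ₀ j * Complex.exp (-(Complex.I * θ)) ^ 2 ≠ 0 := fun j h =>
    hne j (sub_eq_zero.1 h).symm
  have h4 : 4 * |Real.cos θ ^ 2 - Real.cos (θ₀ / 2) ^ 2| =
      (2 * |Real.sin (θ₀ / 2 - θ)|) * (2 * |Real.sin (-θ₀ / 2 - θ)|) := by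
    have hprod : Real.sin (θ₀ / 2 - θ) * Real.sin (-θ₀ / 2 - θ) =
        -(Real.cos θ ^ 2 - Real.cos (θ₀ / 2) ^ 2) := by
      rw [neg_div, Real.sin_sub, Real.sin_sub, Real.sin_neg, Real.cos_neg]
      linear_combination Real.cos (θ₀ / 2) ^ 2 * Real.sin_sq_add_cos_sq θ -
        Real.cos θ ^ 2 * Real.sin_sq_add_cos_sq (θ₀ / 2)
    rw [mul_mul_mul_comm, ← abs_mul, hprod, abs_neg]
    norm_num
  have hγ := Real.mul_rpow (x := 2 * |Real.sin (θ₀ / 2 - θ)|) (y := 2 * |Real.sin (-θ₀ / 2 - θ)|)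
    (z := γ) (by positivity) (by positivity)
  have hcos : Real.sin (Real.pi / 2 - θ) = Real.cos θ := Real.sin_pi_div_two_sub θ
  have hsin : |Real.sin (0 / 2 - θ)| = |Real.sin θ| := by simp
  have hα2 : 2 * (α + 1 / 2) = 2 * α + 1 := by ring
  have hβ2 : 2 * (β + 1 / 2) = 2 * β + 1 := by ring
  have hγ2 : 2 * (γ / 2) = γ := by ring
  rw [h4, hγ, mul_sub, sub_eq_add_neg (2 * lam * _), Real.exp_add]
  simp only [prodNormSq, Complex.ofReal_one, one_mul, norm_cpow_sq (hne' _),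
    norm_one_sub_szegoNode_mul, Fin.prod_univ_four, szegoExponent, Matrix.cons_val,
    Complex.add_re, Complex.sub_re, Complex.add_im, Complex.sub_im, Complex.ofReal_re,
    Complex.ofReal_im, Complex.re_ofReal_mul, Complex.im_ofReal_mul, Complex.I_re, Complex.I_im,
    mul_zero, mul_one, add_zero, sub_zero, zero_add, zero_sub, neg_zero, Real.exp_zero,
    hcos, hsin, hα2, hβ2, hγ2]
  ring_nf

lemma arg_sub_arg_one_sub_szegoNode_mul {θ₀ θ : ℝ} (hθ₀ : θ₀ ∈ Ioo 0 Real.pi)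
    (hne : ∀ j, szegoNode θ₀ j * Complex.exp (-(Complex.I * θ)) ^ 2 ≠ 1) :
    (Real.cos (2 * θ) < Real.cos θ₀ →
      (1 - szegoNode θ₀ 2 * Complex.exp (-(Complex.I * θ)) ^ 2).arg -
        (1 - szegoNode θ₀ 3 * Complex.exp (-(Complex.I * θ)) ^ 2).arg = θ₀) ∧
    (Real.cos θ₀ < Real.cos (2 * θ) →
      (1 - szegoNode θ₀ 2 * Complex.exp (-(Complex.I * θ)) ^ 2).arg -
        (1 - szegoNode θ₀ 3 * Complex.exp (-(Complex.I * θ)) ^ 2).arg = θ₀ - Real.pi) := by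
  have hre : ∀ j, 0 < (1 - szegoNode θ₀ j * Complex.exp (-(Complex.I * θ)) ^ 2).re := by
    intro j
    have hn : ‖szegoNode θ₀ j * Complex.exp (-(Complex.I * θ)) ^ 2‖ = 1 := by
      rw [norm_mul, norm_szegoNode, norm_pow, norm_exp_neg_I_mul, one_pow, one_mul]
    have hle := (Complex.re_le_norm _).trans hn.le
    rw [Complex.sub_re, Complex.one_re, sub_pos]
    refine hle.lt_of_ne fun h => hne j ?_
    have him : (szegoNode θ₀ j * Complex.exp (-(Complex.I * θ)) ^ 2).im = 0 := by
      have h2 := Complex.sq_norm (szegoNode θ₀ j * Complex.exp (-(Complex.I * θ)) ^ 2)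
      rw [hn, Complex.normSq_apply, h] at h2
      exact mul_self_eq_zero.1 (by linarith)
    exact Complex.ext h him
  have key := one_sub_szegoNode_mul_conj θ₀ θ
  obtain ⟨h0, hpi⟩ := hθ₀
  refine ⟨fun h => ?_, fun h => ?_⟩
  · exact arg_sub_arg_of_mul_conj_eq (hre 2) (hre 3) (by linarith) ⟨by linarith, hpi.le⟩ key
  · refine arg_sub_arg_of_mul_conj_eq (hre 2) (hre 3) (r := 2 * (Real.cos (2 * θ) - Real.cos θ₀))
      (by linarith) ⟨by linarith, by linarith⟩ (key.trans ?_)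
    rw [Complex.ofReal_sub, sub_mul, Complex.exp_sub_pi_mul_I]
    push_cast
    ring

/-- The circle weight is, almost everywhere, a multiple of the squared modulus of a product of
powers. -/
lemma circleWeight_eq {A B α β γ xt θ₀ lam : ℝ} {wt : ℝ → ℝ} (hA : 0 < A)
    (hAB : B = A * Real.exp (2 * Real.pi * lam)) (hxt_pos : 0 < xt)
    (hxt : xt = Real.cos (θ₀ / 2)) (hθ₀ : θ₀ ∈ Ioo 0 Real.pi)
    (hwt : ∀ x ∈ Ioo (-1 : ℝ) 1,
      (|x| < xt →
        wt x = B * |x| ^ (2 * β + 1) * (xt ^ 2 - x ^ 2) ^ γ * (1 - x ^ 2) ^ α) ∧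
      (xt < |x| →
        wt x = A * |x| ^ (2 * β + 1) * (x ^ 2 - xt ^ 2) ^ γ * (1 - x ^ 2) ^ α))
    {θ : ℝ} (hne : ∀ j, szegoNode θ₀ j * Complex.exp (-(Complex.I * θ)) ^ 2 ≠ 1) :
    wt (Real.cos θ) * |Real.sin θ| =
      A * Real.exp (2 * lam * (Real.pi - θ₀)) *
        ((2 : ℝ) ^ (2 * α + 1) * (2 : ℝ) ^ (2 * β + 1) * (4 : ℝ) ^ γ)⁻¹ *
      prodNormSq Finset.univ (szegoExponent α β γ lam) (szegoNode θ₀) 1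
        (Complex.exp (-(Complex.I * θ)) ^ 2) := by
  have hpos : ∀ j, 0 < ‖1 - szegoNode θ₀ j * Complex.exp (-(Complex.I * θ)) ^ 2‖ := fun j =>
    norm_pos_iff.2 fun h => hne j (sub_eq_zero.1 h).symm
  have hs : 0 < |Real.sin θ| := by
    have := hpos 0
    rw [norm_one_sub_szegoNode_mul] at this
    simpa using this
  have hcos1 : Real.cos θ ^ 2 < 1 := by
    have h := Real.sin_sq_add_cos_sq θ
    have := pow_pos hs 2
    rw [sq_abs] at this
    linarith
  have hmem : Real.cos θ ∈ Ioo (-1 : ℝ) 1 := by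
    rw [mem_Ioo, ← abs_lt, ← sq_lt_one_iff_abs_lt_one]
    exact hcos1
  obtain ⟨hw1, hw2⟩ := hwt _ hmem
  have hsin : (1 - Real.cos θ ^ 2) ^ α * |Real.sin θ| = |Real.sin θ| ^ (2 * α + 1) := by
    rw [← Real.sin_sq, ← sq_abs, Real.rpow_add hs, Real.rpow_one, Real.rpow_mul hs.le,
      Real.rpow_two]
  obtain ⟨harg1, harg2⟩ := arg_sub_arg_one_sub_szegoNode_mul hθ₀ hne
  have hc2 : Real.cos (2 * θ) = 2 * Real.cos θ ^ 2 - 1 := Real.cos_two_mul θ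
  have hc0 : Real.cos θ₀ = 2 * xt ^ 2 - 1 := by
    rw [hxt, ← Real.cos_two_mul]; congr 1; ring
  rw [prodNormSq_szego α β γ lam hne, ← hxt, Real.mul_rpow zero_le_two (abs_nonneg _),
    Real.mul_rpow zero_le_two (abs_nonneg _), Real.mul_rpow (by norm_num) (abs_nonneg _), ← hsin]
  have h2α : (2 : ℝ) ^ (2 * α + 1) ≠ 0 := by positivity
  have h2β : (2 : ℝ) ^ (2 * β + 1) ≠ 0 := by positivity
  have h4γ : (4 : ℝ) ^ γ ≠ 0 := by positivity
  rcases lt_trichotomy |Real.cos θ| xt with h | h | h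
  · have hlt : Real.cos θ ^ 2 < xt ^ 2 := by
      rw [← sq_abs]; exact pow_lt_pow_left₀ h (abs_nonneg _) two_ne_zero
    rw [hw1 h, harg1 (by linarith), abs_of_neg (sub_neg.2 hlt), neg_sub, hAB,
      show 2 * Real.pi * lam = 2 * lam * (Real.pi - θ₀) + 2 * lam * θ₀ by ring, Real.exp_add]
    field_simp
  · exfalso
    have h23 : ‖1 - szegoNode θ₀ 2 * Complex.exp (-(Complex.I * θ)) ^ 2‖ *
        ‖1 - szegoNode θ₀ 3 * Complex.exp (-(Complex.I * θ)) ^ 2‖ = 0 := by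
      rw [← Complex.norm_conj (1 - szegoNode θ₀ 3 * _), ← norm_mul, one_sub_szegoNode_mul_conj,
        hc0, hc2, ← h, sq_abs]
      simp
    exact (mul_pos (hpos 2) (hpos 3)).ne' h23
  · have hlt : xt ^ 2 < Real.cos θ ^ 2 := by
      rw [← sq_abs (Real.cos θ)]; exact pow_lt_pow_left₀ h hxt_pos.le two_ne_zero
    have hexp : Real.exp (2 * lam * (Real.pi - θ₀)) * Real.exp (2 * lam * (θ₀ - Real.pi)) = 1 := by
      rw [← Real.exp_add, ← Real.exp_zero]; congr 1; ring
    rw [hw2 h, harg2 (by linarith), abs_of_pos (sub_pos.2 hlt)]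
    field_simp
    linear_combination (-(|Real.cos θ| ^ (2 * β + 1) * (Real.cos θ ^ 2 - xt ^ 2) ^ γ *
      (1 - Real.cos θ ^ 2) ^ α)) * hexp

end Szego

/-- limits of the (scaled) coefficients `κ̃ₙ'/κ̃ₙ` and
`κ̃ₙ''/κ̃ₙ` (i.e. of `z^(n-2)` and `z^(n-4)`) of the orthonormal polynomials
on the unit circle for the weight `θ ↦ wt (cos θ) |sin θ|`. -/
theorem stmt18
    (A B α β γ x₀ : ℝ)
    (hA : 0 < A) (hB : 0 < B)
    (hα : -1 < α) (hβ : -1 < β) (hγ : -1 < γ)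
    (hx₀ : x₀ ∈ Set.Ioo (-1 : ℝ) 1)
    (xt : ℝ) (hxt_pos : 0 < xt) (hxt : 2 * xt ^ 2 - 1 = x₀)
    (A' B' : ℝ)
    (hA' : A' = (2 : ℝ) ^ (α + β + γ + 1) * A)
    (hB' : B' = (2 : ℝ) ^ (α + β + γ + 1) * B)
    (wt : ℝ → ℝ)
    (hwt : ∀ x ∈ Set.Ioo (-1 : ℝ) 1,
      (|x| < xt →
        wt x = B' * |x| ^ (2 * β + 1) * (xt ^ 2 - x ^ 2) ^ γ * (1 - x ^ 2) ^ α) ∧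
      (xt < |x| →
        wt x = A' * |x| ^ (2 * β + 1) * (x ^ 2 - xt ^ 2) ^ γ * (1 - x ^ 2) ^ α))
    (θ₀ : ℝ) (hθ₀ : θ₀ ∈ Set.Ioo 0 Real.pi) (hx₀θ : x₀ = Real.cos θ₀)
    (lam : ℝ) (hlam : lam = Real.log (B / A) / (2 * Real.pi))
    (φ : ℕ → Polynomial ℂ)
    (hφdeg : ∀ n, (φ n).natDegree = n)
    (κ : ℕ → ℝ)
    (hκpos : ∀ n, 0 < κ n)
    (hκ : ∀ n, (φ n).coeff n = (κ n : ℂ))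
    (hφodd : ∀ n j : ℕ, ¬ (n % 2 = j % 2) → (φ n).coeff j = 0)
    (hφorth : ∀ m n, (∫ θ in Set.Ioo (-Real.pi) Real.pi,
        Polynomial.eval (Complex.exp (Complex.I * (θ : ℂ))) (φ m)
          * (starRingEnd ℂ) (Polynomial.eval (Complex.exp (Complex.I * (θ : ℂ))) (φ n))
          * ((wt (Real.cos θ) * |Real.sin θ| : ℝ) : ℂ))
        = if m = n then 1 else 0) :
    Filter.Tendsto (fun n : ℕ => (φ n).coeff (n - 2) / (κ n : ℂ)) Filter.atTop
      (nhds ((α - β + γ * x₀ + 2 * lam * Real.sin θ₀ : ℝ) : ℂ)) ∧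
    Filter.Tendsto (fun n : ℕ => (φ n).coeff (n - 4) / (κ n : ℂ)) Filter.atTop
      (nhds (((α - β) ^ 2 / 2 + (α + β + 1) / 2
          + (α - β) * (γ * x₀ + 2 * lam * Real.sin θ₀)
          + (γ * (γ + 2) / 4 - lam ^ 2) * Real.cos (2 * θ₀)
          + lam * (γ + 1) * Real.sin (2 * θ₀) + γ ^ 2 / 4 + lam ^ 2 : ℝ) : ℂ)) := by
  have hlead : ∀ n, (φ n).coeff n ≠ 0 := fun n => by
    rw [hκ, Complex.ofReal_ne_zero]
    exact (hκpos n).ne'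
  have hxt_cos : xt = Real.cos (θ₀ / 2) := by
    have hc : 0 < Real.cos (θ₀ / 2) :=
      Real.cos_pos_of_mem_Ioo ⟨by linarith [hθ₀.1, Real.pi_pos], by linarith [hθ₀.2]⟩
    have h2 : Real.cos θ₀ = 2 * Real.cos (θ₀ / 2) ^ 2 - 1 := by
      rw [← Real.cos_two_mul]; congr 1; ring
    exact (pow_left_inj₀ hxt_pos.le hc.le two_ne_zero).1 (by linarith)
  have hA'pos : 0 < A' := by rw [hA']; positivity
  have hAB : B' = A' * Real.exp (2 * Real.pi * lam) := by
    have : 2 * Real.pi * lam = Real.log (B / A) := by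
      rw [hlam]; field_simp
    rw [this, Real.exp_log (by positivity), hA', hB']
    field_simp
  have hInt : IntegrableOn (fun θ => wt (Real.cos θ) * |Real.sin θ|)
      (Set.Ioo (-Real.pi) Real.pi) := by
    have h0 := hφorth 0 0
    have hC : φ 0 = Polynomial.C (κ 0 : ℂ) := by
      rw [← hκ 0]
      exact Polynomial.eq_C_of_natDegree_eq_zero (hφdeg 0)
    simp only [hC, Polynomial.eval_C, if_true] at h0
    rw [integral_const_mul, integral_complex_ofReal] at h0
    by_contra hcon
    rw [integral_undef hcon] at h0
    simp at h0
  have hae : ∀ᵐ θ : ℝ ∂(volume.restrict (Set.Ioo (-Real.pi) Real.pi)),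
      ∀ j, szegoNode θ₀ j * Complex.exp (-(Complex.I * θ)) ^ 2 ≠ 1 :=
    ae_restrict_of_ae (Filter.eventually_all.2 fun j => ae_mul_exp_sq_ne_one (szegoNode θ₀ j))
  have hlim := tendsto_coeff_of_prodNormSq (norm_szegoNode θ₀) (w := fun θ =>
      wt (Real.cos θ) * |Real.sin θ|) (a := szegoExponent α β γ lam)
    (c := A' * Real.exp (2 * lam * (Real.pi - θ₀)) *
      ((2 : ℝ) ^ (2 * α + 1) * (2 : ℝ) ^ (2 * β + 1) * (4 : ℝ) ^ γ)⁻¹) (by positivity)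
    (hae.mono fun θ hθ => circleWeight_eq hA'pos hAB hxt_pos hxt_cos hθ₀ hwt hθ)
    hInt hφdeg hlead (fun m n hmn => by rw [hφorth, if_neg hmn])
  rw [sum_exponent_mul_node, sum_exponent_mul_node_sq] at hlim
  simp only [hκ] at hlim
  rw [hx₀θ]
  refine ⟨hlim.1, ?_⟩
  convert hlim.2 using 2
  norm_cast
  rw [Real.cos_two_mul, Real.sin_two_mul]
  linear_combination (-2 * lam ^ 2) * Real.sin_sq_add_cos_sq θ₀
end
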